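/- Let j be a natural number. If j is not of the form s·(m−n)+1 for some s ∈ {1,…,n}, then the local cohomology module H^j_I(S) of S with support in I vanishes, i.e., (localCohomology I j).obj (ModuleCat.of S S) is subsingleton. -/

import Mathlib

/-! The relative de Rham algebra of the universal left inverse. -/

namespace LeftInverse

/-- Generators: the entries of the universal left inverse and their differentials. -/
inductive Gen (ι κ : Type)
  | inv (j : κ) (a : ι)
  | diff (j : κ) (a : ι)

section Basic

variable {R : Type} [CommRing R] {ι κ : Type} [Fintype ι] [DecidableEq κ]

/-- `l` and `θ` satisfy the relations of a left inverse of `X` and of its differential. -/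
structure Realizes {T : Type} [Ring T] (X : Matrix ι κ R) (f : R →+* T) (l θ : Matrix κ ι T) :
    Prop where
  comm_l : ∀ r j a, f r * l j a = l j a * f r
  comm_θ : ∀ r j a, f r * θ j a = θ j a * f r
  l_l : ∀ j a k b, l j a * l k b = l k b * l j a
  l_θ : ∀ j a k b, l j a * θ k b = θ k b * l j a
  θ_θ : ∀ j a k b, θ j a * θ k b + θ k b * θ j a = 0
  l_X : l * X.map f = 1
  θ_X : θ * X.map f = 0

/-- The defining relations. -/
inductive Rel (X : Matrix ι κ R) :
    FreeAlgebra R (Gen ι κ) → FreeAlgebra R (Gen ι κ) → Prop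
  | l_l (j a k b) : Rel X (FreeAlgebra.ι R (Gen.inv j a) * FreeAlgebra.ι R (Gen.inv k b))
      (FreeAlgebra.ι R (Gen.inv k b) * FreeAlgebra.ι R (Gen.inv j a))
  | l_θ (j a k b) : Rel X (FreeAlgebra.ι R (Gen.inv j a) * FreeAlgebra.ι R (Gen.diff k b))
      (FreeAlgebra.ι R (Gen.diff k b) * FreeAlgebra.ι R (Gen.inv j a))
  | θ_θ (j a k b) : Rel X (FreeAlgebra.ι R (Gen.diff j a) * FreeAlgebra.ι R (Gen.diff k b) +
      FreeAlgebra.ι R (Gen.diff k b) * FreeAlgebra.ι R (Gen.diff j a)) 0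
  | l_X (j k) : Rel X (∑ a, FreeAlgebra.ι R (Gen.inv j a) * algebraMap R (FreeAlgebra R (Gen ι κ)) (X a k))
      ((1 : Matrix κ κ (FreeAlgebra R (Gen ι κ))) j k)
  | θ_X (j k) : Rel X (∑ a, FreeAlgebra.ι R (Gen.diff j a) * algebraMap R (FreeAlgebra R (Gen ι κ)) (X a k)) 0

/-- The relative de Rham algebra of `R[L] / (L * X - 1)` over `R`. -/
def DR (X : Matrix ι κ R) : Type := RingQuot (Rel X)

variable (X : Matrix ι κ R)

noncomputable instance : Ring (DR X) := inferInstanceAs (Ring (RingQuot (Rel X)))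
noncomputable instance : Algebra R (DR X) := inferInstanceAs (Algebra R (RingQuot (Rel X)))

/-- The quotient map from the free algebra. -/
noncomputable def DR.mk : FreeAlgebra R (Gen ι κ) →ₐ[R] DR X := RingQuot.mkAlgHom R (Rel X)

/-- The universal left inverse. -/
noncomputable def DR.l : Matrix κ ι (DR X) := fun j a => DR.mk X (FreeAlgebra.ι R (Gen.inv j a))

/-- The differential of the universal left inverse. -/
noncomputable def DR.θ : Matrix κ ι (DR X) := fun j a => DR.mk X (FreeAlgebra.ι R (Gen.diff j a))

lemma DR.mk_rel {a b} (h : Rel X a b) : DR.mk X a = DR.mk X b := RingQuot.mkAlgHom_rel R h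

lemma DR.realizes : Realizes X (algebraMap R (DR X)) (DR.l X) (DR.θ X) where
  comm_l r j a := Algebra.commutes _ _
  comm_θ r j a := Algebra.commutes _ _
  l_l j a k b := by simpa [DR.l, DR.θ] using DR.mk_rel X (Rel.l_l j a k b)
  l_θ j a k b := by simpa [DR.l, DR.θ] using DR.mk_rel X (Rel.l_θ j a k b)
  θ_θ j a k b := by simpa [DR.l, DR.θ] using DR.mk_rel X (Rel.θ_θ j a k b)
  l_X := by
    ext j k
    have := DR.mk_rel X (Rel.l_X j k)
    simp only [map_sum, map_mul, AlgHom.commutes] at this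
    simp only [Matrix.mul_apply, Matrix.map_apply]
    refine this.trans ?_
    by_cases h : j = k <;> simp [Matrix.one_apply, h]
  θ_X := by
    ext j k
    simpa [Matrix.mul_apply, DR.θ] using DR.mk_rel X (Rel.θ_X j k)

variable {X}

@[elab_as_elim]
lemma DR.induction {p : DR X → Prop} (hr : ∀ r, p (algebraMap R _ r))
    (hl : ∀ j a, p (DR.l X j a)) (hθ : ∀ j a, p (DR.θ X j a))
    (hadd : ∀ a b, p a → p b → p (a + b)) (hmul : ∀ a b, p a → p b → p (a * b)) (w : DR X) :
    p w := by
  obtain ⟨w, rfl⟩ := RingQuot.mkAlgHom_surjective R (Rel X) w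
  change p (DR.mk X w)
  induction w using FreeAlgebra.induction with
  | grade0 r => simpa using hr r
  | grade1 g =>
    cases g with
    | inv j a => exact hl j a
    | diff j a => exact hθ j a
  | mul a b ha hb => rw [map_mul]; exact hmul _ _ ha hb
  | add a b ha hb => rw [map_add]; exact hadd _ _ ha hb

lemma Realizes.exists_hom {T : Type} [Ring T] {f : R →+* T} {l θ : Matrix κ ι T}
    (h : Realizes X f l θ) : ∃ F : DR X →+* T, (∀ r, F (algebraMap R _ r) = f r) ∧
      (∀ j a, F (DR.l X j a) = l j a) ∧ (∀ j a, F (DR.θ X j a) = θ j a) := by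
  let T' := Subring.centralizer (Set.range f)
  have hf : ∀ r, f r ∈ T' := fun r => by
    rw [Subring.mem_centralizer_iff]
    rintro _ ⟨s, rfl⟩
    rw [← map_mul, ← map_mul, mul_comm]
  have hl : ∀ j a, l j a ∈ T' := fun j a => by
    rw [Subring.mem_centralizer_iff]
    rintro _ ⟨s, rfl⟩
    exact h.comm_l s j a
  have hθ : ∀ j a, θ j a ∈ T' := fun j a => by
    rw [Subring.mem_centralizer_iff]
    rintro _ ⟨s, rfl⟩
    exact h.comm_θ s j a
  let f' : R →+* T' := f.codRestrict T' hf
  let _ : Algebra R T' := f'.toAlgebra' (fun r x => by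
    apply Subtype.ext
    exact Subring.mem_centralizer_iff.1 x.2 _ ⟨r, rfl⟩)
  let g : Gen ι κ → T' := fun x => match x with
    | .inv j a => ⟨l j a, hl j a⟩
    | .diff j a => ⟨θ j a, hθ j a⟩
  let G : FreeAlgebra R (Gen ι κ) →ₐ[R] T' := FreeAlgebra.lift R g
  have ha : ∀ r, ((algebraMap R T' r : T') : T) = f r := fun r => rfl
  have hG : ∀ ⦃x y⦄, Rel X x y → G x = G y := by
    intro x y hxy
    apply Subtype.ext
    cases hxy with
    | l_l j a k b => simpa [G, g] using h.l_l j a k b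
    | l_θ j a k b => simpa [G, g] using h.l_θ j a k b
    | θ_θ j a k b => simpa [G, g] using h.θ_θ j a k b
    | l_X j k =>
      have := congrFun (congrFun h.l_X j) k
      simp only [Matrix.mul_apply, Matrix.map_apply] at this
      have h1 : ((G ((1 : Matrix κ κ (FreeAlgebra R (Gen ι κ))) j k) : T') : T)
          = (1 : Matrix κ κ T) j k := by
        by_cases hjk : j = k <;> simp [Matrix.one_apply, hjk]
      rw [h1, ← this]
      simp [G, g, ha]
    | θ_X j k =>
      have := congrFun (congrFun h.θ_X j) k
      simp only [Matrix.mul_apply, Matrix.map_apply] at this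
      simpa [G, g, ha] using this
  let F : DR X →ₐ[R] T' := RingQuot.liftAlgHom R ⟨G, hG⟩
  have hF : ∀ x, F (DR.mk X x) = G x := fun x => RingQuot.liftAlgHom_mkAlgHom_apply R G hG x
  refine ⟨T'.subtype.comp F.toRingHom, fun r => ?_, fun j a => ?_, fun j a => ?_⟩
  · change ((F (algebraMap R _ r) : T') : T) = _
    rw [F.commutes]; rfl
  · change ((F (DR.mk X _) : T') : T) = _
    rw [hF]; simp [G, g]
  · change ((F (DR.mk X _) : T') : T) = _
    rw [hF]; simp [G, g]

/-- The universal property of the de Rham algebra. -/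
noncomputable def DR.lift {T : Type} [Ring T] {f : R →+* T} {l θ : Matrix κ ι T}
    (h : Realizes X f l θ) : DR X →+* T := h.exists_hom.choose

@[simp] lemma DR.lift_algebraMap {T : Type} [Ring T] {f : R →+* T} {l θ : Matrix κ ι T}
    (h : Realizes X f l θ) (r : R) : DR.lift h (algebraMap R _ r) = f r :=
  h.exists_hom.choose_spec.1 r

@[simp] lemma DR.lift_l {T : Type} [Ring T] {f : R →+* T} {l θ : Matrix κ ι T}
    (h : Realizes X f l θ) (j a) : DR.lift h (DR.l X j a) = l j a :=
  h.exists_hom.choose_spec.2.1 j a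

@[simp] lemma DR.lift_θ {T : Type} [Ring T] {f : R →+* T} {l θ : Matrix κ ι T}
    (h : Realizes X f l θ) (j a) : DR.lift h (DR.θ X j a) = θ j a :=
  h.exists_hom.choose_spec.2.2 j a

lemma DR.hom_ext {T : Type} [Ring T] {F G : DR X →+* T}
    (hr : ∀ r, F (algebraMap R _ r) = G (algebraMap R _ r))
    (hl : ∀ j a, F (DR.l X j a) = G (DR.l X j a))
    (hθ : ∀ j a, F (DR.θ X j a) = G (DR.θ X j a)) : F = G := by
  ext w
  induction w using DR.induction with
  | hr r => exact hr r
  | hl j a => exact hl j a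
  | hθ j a => exact hθ j a
  | hadd a b ha hb => rw [map_add, map_add, ha, hb]
  | hmul a b ha hb => rw [map_mul, map_mul, ha, hb]

/-- Two skew derivations which agree on generators are equal. -/
lemma DR.skew_ext {T : Type} [Ring T] {σ τ : DR X → T} {F G : DR X →+ T}
    (hF : ∀ a b, F (a * b) = F a * τ b + σ a * F b)
    (hG : ∀ a b, G (a * b) = G a * τ b + σ a * G b)
    (hr : ∀ r, F (algebraMap R _ r) = G (algebraMap R _ r))
    (hl : ∀ j a, F (DR.l X j a) = G (DR.l X j a))
    (hθ : ∀ j a, F (DR.θ X j a) = G (DR.θ X j a)) (w : DR X) : F w = G w := by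
  induction w using DR.induction with
  | hr r => exact hr r
  | hl j a => exact hl j a
  | hθ j a => exact hθ j a
  | hadd a b ha hb => rw [map_add, map_add, ha, hb]
  | hmul a b ha hb => rw [hF, hG, ha, hb]

lemma DR.l_comm (j a) (w : DR X) : DR.l X j a * w = w * DR.l X j a := by
  induction w using DR.induction with
  | hr r => exact (Algebra.commutes _ _).symm
  | hl k b => exact (DR.realizes X).l_l _ _ _ _
  | hθ k b => exact (DR.realizes X).l_θ _ _ _ _
  | hadd a b ha hb => rw [mul_add, add_mul, ha, hb]
  | hmul a b ha hb => rw [← mul_assoc, ha, mul_assoc, hb, mul_assoc]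

variable (X) in
/-- The parity automorphism, as realization data. -/
lemma DR.realizes_parity : Realizes X (algebraMap R (DR X)) (DR.l X) (-DR.θ X) where
  comm_l r j a := Algebra.commutes _ _
  comm_θ r j a := Algebra.commutes _ _
  l_l := (DR.realizes X).l_l
  l_θ j a k b := by simpa using (DR.realizes X).l_θ j a k b
  θ_θ j a k b := by simpa using (DR.realizes X).θ_θ j a k b
  l_X := (DR.realizes X).l_X
  θ_X := by rw [Matrix.neg_mul, (DR.realizes X).θ_X, neg_zero]

variable (X) in
/-- The parity automorphism. -/
noncomputable def DR.parity : DR X →+* DR X := DR.lift (DR.realizes_parity X)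

@[simp] lemma DR.parity_algebraMap (r : R) :
    DR.parity X (algebraMap R _ r) = algebraMap R _ r := DR.lift_algebraMap _ _
@[simp] lemma DR.parity_l (j a) : DR.parity X (DR.l X j a) = DR.l X j a := DR.lift_l _ _ _
@[simp] lemma DR.parity_θ (j a) : DR.parity X (DR.θ X j a) = -DR.θ X j a := DR.lift_θ _ _ _

@[simp] lemma DR.parity_parity (w : DR X) : DR.parity X (DR.parity X w) = w := by
  have : (DR.parity X).comp (DR.parity X) = RingHom.id _ :=
    DR.hom_ext (by simp) (by simp) (by simp)
  exact congrArg (fun f => f w) this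

/-- Values on generators that extend to a `σ`-derivation of the de Rham algebra. -/
structure SkewData (σ : DR X →+* DR X) (δ : R → DR X) (l' θ' : Matrix κ ι (DR X)) : Prop where
  σ_r : ∀ r, σ (algebraMap R _ r) = algebraMap R _ r
  σ_l : ∀ j a, σ (DR.l X j a) = DR.l X j a
  δ_add : ∀ r s, δ (r + s) = δ r + δ s
  δ_mul : ∀ r s, δ (r * s) = r • δ s + s • δ r
  δ_comm : ∀ r w, δ r * w = σ w * δ r
  l'_comm : ∀ j a k b, l' j a * DR.θ X k b = σ (DR.θ X k b) * l' j a
  anti : ∀ j a k b, σ (DR.θ X j a) * θ' k b + θ' j a * DR.θ X k b +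
    (σ (DR.θ X k b) * θ' j a + θ' k b * DR.θ X j a) = 0
  l'_X : DR.l X * X.map δ + l' * X.map (algebraMap R (DR X)) = 0
  θ'_X : (DR.θ X).map σ * X.map δ + θ' * X.map (algebraMap R (DR X)) = 0

lemma SkewData.exists_skew {σ : DR X →+* DR X} {δ : R → DR X} {l' θ' : Matrix κ ι (DR X)}
    (h : SkewData σ δ l' θ') : ∃ F : DR X →+ DR X, (∀ a b, F (a * b) = F a * b + σ a * F b) ∧
      (∀ r, F (algebraMap R _ r) = δ r) ∧
      (∀ j a, F (DR.l X j a) = l' j a) ∧ (∀ j a, F (DR.θ X j a) = θ' j a) := by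
  have δ1 : δ 1 = 0 := by simpa using h.δ_mul 1 1
  have δ0 : δ 0 = 0 := by simpa using h.δ_add 0 0
  have key : ∀ x x' y y' : DR X, !![σ x, x'; 0, x] * !![σ y, y'; 0, y] =
      !![σ (x * y), σ x * y' + x' * y; 0, x * y] := by
    intro x x' y y'
    simp
  let f : R →+* Matrix (Fin 2) (Fin 2) (DR X) :=
    { toFun := fun r => !![σ (algebraMap R _ r), δ r; 0, algebraMap R _ r]
      map_one' := by
        ext i j; fin_cases i <;> fin_cases j <;> simp [δ1]
      map_zero' := by
        ext i j; fin_cases i <;> fin_cases j <;> simp [δ0]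
      map_mul' := fun r s => by
        rw [key]
        ext i j; fin_cases i <;> fin_cases j <;> simp [h.δ_mul, h.σ_r, Algebra.smul_def]
        exact (Algebra.commutes _ _)
      map_add' := fun r s => by
        ext i j; fin_cases i <;> fin_cases j <;> simp [h.δ_add] }
  let l : Matrix κ ι (Matrix (Fin 2) (Fin 2) (DR X)) := fun j a =>
    !![σ (DR.l X j a), l' j a; 0, DR.l X j a]
  let θ : Matrix κ ι (Matrix (Fin 2) (Fin 2) (DR X)) := fun j a =>
    !![σ (DR.θ X j a), θ' j a; 0, DR.θ X j a]
  have hf : ∀ r, f r = !![σ (algebraMap R _ r), δ r; 0, algebraMap R _ r] := fun r => rfl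
  have hl : ∀ j a, l j a = !![σ (DR.l X j a), l' j a; 0, DR.l X j a] := fun _ _ => rfl
  have hθ : ∀ j a, θ j a = !![σ (DR.θ X j a), θ' j a; 0, DR.θ X j a] := fun _ _ => rfl
  have hz := DR.realizes X
  have H : Realizes X f l θ :=
    { comm_l := fun r j a => by
        rw [hf, hl, key, key, hz.comm_l, h.δ_comm, h.σ_r, Algebra.commutes, add_comm]
      comm_θ := fun r j a => by
        rw [hf, hθ, key, key, hz.comm_θ, h.δ_comm, h.σ_r, Algebra.commutes, add_comm]
      l_l := fun j a k b => by
        rw [hl, hl, key, key, hz.l_l, h.σ_l, h.σ_l, DR.l_comm j a (l' k b),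
          DR.l_comm k b (l' j a), add_comm]
      l_θ := fun j a k b => by
        rw [hl, hθ, key, key, hz.l_θ, h.σ_l, DR.l_comm, h.l'_comm, add_comm]
      θ_θ := fun j a k b => by
        rw [hθ, hθ, key, key]
        have h1 := hz.θ_θ j a k b
        have h2 := h.anti j a k b
        have h3 := congrArg σ h1
        simp only [map_add, map_mul, map_zero] at h3
        ext i j; fin_cases i <;> fin_cases j <;> simp [h1, h2, h3]
      l_X := by
        refine Matrix.ext fun j k => ?_
        have h1 : ∑ a, (DR.l X j a * δ (X a k) + l' j a * algebraMap R (DR X) (X a k)) = 0 := by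
          rw [Finset.sum_add_distrib]
          exact congrFun (congrFun h.l'_X j) k
        have h2 := congrFun (congrFun hz.l_X j) k
        have h3 := congrArg σ h2
        simp only [Matrix.mul_apply, Matrix.map_apply] at h2 h3
        simp only [Matrix.mul_apply, Matrix.map_apply, hl, hf, key]
        ext p q
        rw [Matrix.sum_apply]
        by_cases hjk : j = k
        · subst hjk
          fin_cases p <;> fin_cases q <;> simp_all [h.σ_l, h.σ_r]
        · fin_cases p <;> fin_cases q <;> simp_all [h.σ_l, h.σ_r]
      θ_X := by
        refine Matrix.ext fun j k => ?_
        have h1 : ∑ a, (σ (DR.θ X j a) * δ (X a k) + θ' j a * algebraMap R (DR X) (X a k)) = 0 := by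
          rw [Finset.sum_add_distrib]
          exact congrFun (congrFun h.θ'_X j) k
        have h2 := congrFun (congrFun hz.θ_X j) k
        have h3 := congrArg σ h2
        simp only [Matrix.mul_apply, Matrix.map_apply, Matrix.zero_apply, map_sum, map_mul,
          h.σ_r, map_zero] at h2 h3
        simp only [Matrix.mul_apply, Matrix.map_apply, hθ, hf, key]
        ext p q
        rw [Matrix.sum_apply]
        fin_cases p <;> fin_cases q <;> simp_all [h.σ_r] }
  have hG : ∀ w, DR.lift H w 0 0 = σ w ∧ DR.lift H w 1 0 = 0 ∧ DR.lift H w 1 1 = w := by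
    intro w
    induction w using DR.induction with
    | hr r => simp [hf]
    | hl j a => simp [hl]
    | hθ j a => simp [hθ]
    | hadd a b ha hb => simp [ha, hb]
    | hmul a b ha hb => simp [Matrix.mul_apply, Fin.sum_univ_two, ha, hb]
  refine ⟨{ toFun := fun w => DR.lift H w 0 1, map_zero' := by simp, map_add' := by simp },
    fun a b => ?_, fun r => ?_, fun j a => ?_, fun j a => ?_⟩
  · change DR.lift H (a * b) 0 1 = DR.lift H a 0 1 * b + σ a * DR.lift H b 0 1
    rw [map_mul, Matrix.mul_apply, Fin.sum_univ_two, (hG a).1, (hG b).2.2, add_comm]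
  · simp [hf]
  · simp [hl]
  · simp [hθ]

/-- The `σ`-derivation with given values on generators. -/
noncomputable def SkewData.skew {σ : DR X →+* DR X} {δ : R → DR X} {l' θ' : Matrix κ ι (DR X)}
    (h : SkewData σ δ l' θ') : DR X →+ DR X := h.exists_skew.choose

section

variable {σ : DR X →+* DR X} {δ : R → DR X} {l' θ' : Matrix κ ι (DR X)} (h : SkewData σ δ l' θ')
include h

lemma SkewData.skew_mul (a b) : h.skew (a * b) = h.skew a * b + σ a * h.skew b :=
  h.exists_skew.choose_spec.1 a b

lemma SkewData.skew_algebraMap (r) : h.skew (algebraMap R _ r) = δ r :=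
  h.exists_skew.choose_spec.2.1 r

lemma SkewData.skew_l (j a) : h.skew (DR.l X j a) = l' j a :=
  h.exists_skew.choose_spec.2.2.1 j a

lemma SkewData.skew_θ (j a) : h.skew (DR.θ X j a) = θ' j a :=
  h.exists_skew.choose_spec.2.2.2 j a

end

end Basic

section

variable {A : Type} [Ring A] (F G : AddMonoid.End A) (a : A)

@[simp] lemma end_sub_apply : (F - G) a = F a - G a := rfl
@[simp] lemma end_add_apply : (F + G) a = F a + G a := rfl
@[simp] lemma end_neg_apply : (-F) a = -F a := rfl
@[simp] lemma end_mul_apply : (F * G) a = F (G a) := rfl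
@[simp] lemma end_zero_apply : (0 : AddMonoid.End A) a = 0 := rfl

end

/-- `F` is a `σ`-derivation. -/
def IsSkew {A : Type} [Ring A] (σ : A → A) (F : AddMonoid.End A) : Prop :=
  ∀ a b, F (a * b) = F a * b + σ a * F b

lemma IsSkew.bracket {A : Type} [Ring A] {σ : A →+* A} {D F : AddMonoid.End A}
    (hD : IsSkew id D) (hF : IsSkew σ F) (h : ∀ a, D (σ a) = σ (D a)) :
    IsSkew σ (D * F - F * D) := by
  intro a b
  simp only [end_sub_apply, end_mul_apply, hD a b, hF a b, map_add, hD _ _,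
    hF _ _, id, h, sub_mul, mul_sub]
  abel

lemma IsSkew.add {A : Type} [Ring A] {σ : A → A} {D F : AddMonoid.End A}
    (hD : IsSkew σ D) (hF : IsSkew σ F) : IsSkew σ (D + F) := by
  intro a b
  simp only [end_add_apply, hD a b, hF a b, add_mul, mul_add]
  abel

section

variable {R : Type} [CommRing R] {ι κ : Type} [Fintype ι] [DecidableEq κ] {X : Matrix ι κ R}

namespace DR

lemma isSkew_ext {σ : DR X → DR X} {F G : AddMonoid.End (DR X)} (hF : IsSkew σ F)
    (hG : IsSkew σ G) (hr : ∀ r, F (algebraMap R _ r) = G (algebraMap R _ r))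
    (hl : ∀ j a, F (DR.l X j a) = G (DR.l X j a))
    (hθ : ∀ j a, F (DR.θ X j a) = G (DR.θ X j a)) : F = G :=
  AddMonoidHom.ext fun w => DR.skew_ext (τ := id) hF hG hr hl hθ w

lemma l_mem_center (j a) : l X j a ∈ Subring.center (DR X) := by
  rw [Subring.mem_center_iff]
  exact fun g => (l_comm j a g).symm

lemma algebraMap_mem_center (r : R) : algebraMap R (DR X) r ∈ Subring.center (DR X) := by
  rw [Subring.mem_center_iff]
  exact fun g => (Algebra.commutes r g).symm

lemma mul_mem_center {p q s : Type} [Fintype q] {A : Matrix p q (DR X)} {B : Matrix q s (DR X)}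
    (hA : ∀ i j, A i j ∈ Subring.center (DR X)) (hB : ∀ i j, B i j ∈ Subring.center (DR X))
    (i j) : (A * B) i j ∈ Subring.center (DR X) := by
  rw [Matrix.mul_apply]
  exact sum_mem fun k _ => mul_mem (hA i k) (hB k j)

/-- The differential. -/
lemma data_d : SkewData (parity X) (fun _ => 0) (θ X) 0 where
  σ_r := parity_algebraMap
  σ_l := parity_l
  δ_add := by simp
  δ_mul := by simp
  δ_comm := by simp
  l'_comm j a k b := by
    simpa using eq_neg_of_add_eq_zero_left ((realizes X).θ_θ j a k b)
  anti := by simp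
  l'_X := by
    rw [(realizes X).θ_X, add_zero]
    ext; simp [Matrix.mul_apply]
  θ'_X := by
    ext; simp [Matrix.mul_apply]

variable (X) in
/-- The differential. -/
noncomputable def d : AddMonoid.End (DR X) := data_d.skew (X := X)

lemma d_skew : IsSkew (parity X) (d X) := data_d.skew_mul
lemma d_mul (a b : DR X) : d X (a * b) = d X a * b + parity X a * d X b := d_skew a b
@[simp] lemma d_algebraMap (r : R) : d X (algebraMap R _ r) = 0 := data_d.skew_algebraMap r
@[simp] lemma d_l (j a) : d X (l X j a) = θ X j a := data_d.skew_l j a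
@[simp] lemma d_θ (j a) : d X (θ X j a) = 0 := data_d.skew_θ j a

lemma data_deg : SkewData (RingHom.id (DR X)) (fun _ => 0) 0 (θ X) where
  σ_r := by simp
  σ_l := by simp
  δ_add := by simp
  δ_mul := by simp
  δ_comm := by simp
  l'_comm := by simp
  anti j a k b := by
    have := (realizes X).θ_θ j a k b
    simp only [RingHom.id_apply]
    rw [add_add_add_comm, this, add_zero]
  l'_X := by ext; simp [Matrix.mul_apply]
  θ'_X := by
    rw [(realizes X).θ_X, add_zero]
    ext; simp [Matrix.mul_apply]

lemma end_ext {σ τ : DR X → DR X} {F G : AddMonoid.End (DR X)}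
    (hF : ∀ a b, F (a * b) = F a * τ b + σ a * F b)
    (hG : ∀ a b, G (a * b) = G a * τ b + σ a * G b)
    (hr : ∀ r, F (algebraMap R _ r) = G (algebraMap R _ r))
    (hl : ∀ j a, F (DR.l X j a) = G (DR.l X j a))
    (hθ : ∀ j a, F (DR.θ X j a) = G (DR.θ X j a)) (w : DR X) : F w = G w :=
  DR.skew_ext hF hG hr hl hθ w

variable (X) in
/-- The parity automorphism, as an endomorphism of the additive group. -/
noncomputable def parityEnd : AddMonoid.End (DR X) := (parity X).toAddMonoidHom

@[simp] lemma parityEnd_apply (w : DR X) : parityEnd X w = parity X w := rfl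

variable (X) in
/-- The degree derivation, acting on forms of degree `i` as multiplication by `i`. -/
noncomputable def deg : AddMonoid.End (DR X) := data_deg.skew (X := X)

lemma deg_skew : IsSkew id (deg X) := data_deg.skew_mul
lemma deg_mul (a b : DR X) : deg X (a * b) = deg X a * b + a * deg X b := deg_skew a b
@[simp] lemma deg_algebraMap (r : R) : deg X (algebraMap R _ r) = 0 := data_deg.skew_algebraMap r
@[simp] lemma deg_l (j a) : deg X (l X j a) = 0 := data_deg.skew_l j a
@[simp] lemma deg_θ (j a) : deg X (θ X j a) = θ X j a := data_deg.skew_θ j a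

/-- The matrix `W` can be contracted with. -/
structure IsVertical (W : Matrix κ ι (DR X)) : Prop where
  center : ∀ j a, W j a ∈ Subring.center (DR X)
  deg : ∀ j a, deg X (W j a) = 0
  parity : ∀ j a, parity X (W j a) = W j a
  mul_X : W * X.map (algebraMap R (DR X)) = 0

lemma data_contr {W : Matrix κ ι (DR X)} (hW : IsVertical W) :
    SkewData (parity X) (fun _ => 0) 0 W where
  σ_r := parity_algebraMap
  σ_l := parity_l
  δ_add := by simp
  δ_mul := by simp
  δ_comm := by simp
  l'_comm := by simp
  anti j a k b := by
    have h1 := Subring.mem_center_iff.1 (hW.center k b) (θ X j a)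
    have h2 := Subring.mem_center_iff.1 (hW.center j a) (θ X k b)
    simp [h1, h2]
  l'_X := by ext; simp [Matrix.mul_apply]
  θ'_X := by
    rw [hW.mul_X, add_zero]
    ext; simp [Matrix.mul_apply]

/-- Contraction with a vertical vector field. -/
noncomputable def contr {W : Matrix κ ι (DR X)} (hW : IsVertical W) : AddMonoid.End (DR X) :=
  (data_contr hW).skew

section
variable {W : Matrix κ ι (DR X)} (hW : IsVertical W)

lemma contr_skew : IsSkew (parity X) (contr hW) := (data_contr hW).skew_mul
@[simp] lemma contr_algebraMap (r : R) : contr hW (algebraMap R _ r) = 0 :=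
  (data_contr hW).skew_algebraMap r
@[simp] lemma contr_l (j a) : contr hW (l X j a) = 0 := (data_contr hW).skew_l j a
@[simp] lemma contr_θ (j a) : contr hW (θ X j a) = W j a := (data_contr hW).skew_θ j a

end

/-- An operator which kills `R` and is a skew derivation is `R`-linear. -/
lemma smul_of_skew {σ : DR X →+* DR X} (hσ : ∀ r, σ (algebraMap R _ r) = algebraMap R _ r)
    {F : AddMonoid.End (DR X)} (hF : IsSkew σ F) (h0 : ∀ r, F (algebraMap R _ r) = 0) (r : R)
    (w : DR X) : F (r • w) = r • F w := by
  rw [Algebra.smul_def, hF, h0, hσ, zero_mul, zero_add, Algebra.smul_def]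

lemma d_smul (r : R) (w : DR X) : d X (r • w) = r • d X w :=
  smul_of_skew parity_algebraMap d_skew d_algebraMap r w

lemma deg_smul (r : R) (w : DR X) : deg X (r • w) = r • deg X w :=
  smul_of_skew (σ := RingHom.id _) (by simp) deg_skew deg_algebraMap r w

lemma contr_smul {W : Matrix κ ι (DR X)} (hW : IsVertical W) (r : R) (w : DR X) :
    contr hW (r • w) = r • contr hW w :=
  smul_of_skew parity_algebraMap (contr_skew hW) (contr_algebraMap hW) r w

/-- A parity-odd derivation anticommutes with the parity automorphism. -/
lemma parity_odd {F : AddMonoid.End (DR X)} (hF : IsSkew (parity X) F)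
    (hr : ∀ r, F (algebraMap R _ r) = 0)
    (hl : ∀ j a, parity X (F (l X j a)) = -F (l X j a))
    (hθ : ∀ j a, parity X (F (θ X j a)) = F (θ X j a)) (w : DR X) :
    F (parity X w) = -parity X (F w) := by
  refine end_ext (σ := fun w => parity X (parity X w)) (τ := parity X)
    (F := F * parityEnd X)
    (G := -(parityEnd X * F)) ?_ ?_ ?_ ?_ ?_ w
  · intro a b
    simp [hF _ _]
  · intro a b
    simp [hF _ _]
    abel
  · intro r; simp [hr]
  · intro j a; simp [hl]
  · intro j a; simp [hθ]

/-- A parity-even derivation commutes with the parity automorphism. -/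
lemma parity_even {F : AddMonoid.End (DR X)} (hF : IsSkew id F)
    (hr : ∀ r, parity X (F (algebraMap R _ r)) = F (algebraMap R _ r))
    (hl : ∀ j a, parity X (F (l X j a)) = F (l X j a))
    (hθ : ∀ j a, parity X (F (θ X j a)) = -F (θ X j a)) (w : DR X) :
    F (parity X w) = parity X (F w) := by
  refine end_ext (σ := parity X) (τ := parity X)
    (F := F * parityEnd X)
    (G := parityEnd X * F) ?_ ?_ ?_ ?_ ?_ w
  · intro a b
    simp [hF _ _]
  · intro a b
    simp [hF _ _]
  · intro r; simp [hr]
  · intro j a; simp [hl]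
  · intro j a; simp [hθ]

lemma d_parity (w : DR X) : d X (parity X w) = -parity X (d X w) :=
  parity_odd d_skew (by simp) (by simp) (by simp) w

lemma contr_parity {W : Matrix κ ι (DR X)} (hW : IsVertical W) (w : DR X) :
    contr hW (parity X w) = -parity X (contr hW w) :=
  parity_odd (contr_skew hW) (by simp) (by simp) (by simp [hW.parity]) w

lemma deg_parity (w : DR X) : deg X (parity X w) = parity X (deg X w) :=
  parity_even deg_skew (by simp) (by simp) (by simp) w

lemma d_d (w : DR X) : d X (d X w) = 0 := by
  have : d X * d X = 0 := by
    refine isSkew_ext (σ := id) (fun a b => ?_) (fun a b => by simp) (by simp) (by simp) (by simp)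
    simp [d_mul, d_parity]
  exact DFunLike.congr_fun this w

/-- The Lie derivative along a vertical vector field. -/
noncomputable def vert {W : Matrix κ ι (DR X)} (hW : IsVertical W) : AddMonoid.End (DR X) :=
  d X * contr hW + contr hW * d X

section
variable {W : Matrix κ ι (DR X)} (hW : IsVertical W)

lemma vert_apply (w) : vert hW w = d X (contr hW w) + contr hW (d X w) := rfl

lemma vert_skew : IsSkew id (vert hW) := by
  intro a b
  simp only [vert_apply, contr_skew hW _ _, d_mul, map_add, contr_parity hW, d_parity, id,
    parity_parity, neg_mul]
  noncomm_ring

@[simp] lemma vert_algebraMap (r : R) : vert hW (algebraMap R _ r) = 0 := by simp [vert_apply]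
@[simp] lemma vert_l (j a) : vert hW (l X j a) = W j a := by simp [vert_apply]
@[simp] lemma vert_θ (j a) : vert hW (θ X j a) = d X (W j a) := by simp [vert_apply]

lemma vert_smul (r : R) (w : DR X) : vert hW (r • w) = r • vert hW w := by
  simp [vert_apply, contr_smul, d_smul]

lemma d_vert (w) : d X (vert hW w) = vert hW (d X w) := by simp [vert_apply, d_d]

end

lemma deg_d (w : DR X) : deg X (d X w) = d X (deg X w) + d X w := by
  have : deg X * d X - d X * deg X = d X :=
    isSkew_ext (deg_skew.bracket d_skew deg_parity) d_skew (by simp) (by simp) (by simp)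
  rw [← sub_eq_iff_eq_add']
  exact DFunLike.congr_fun this w

lemma deg_contr {W : Matrix κ ι (DR X)} (hW : IsVertical W) (w : DR X) :
    deg X (contr hW w) = contr hW (deg X w) - contr hW w := by
  have h2 : IsSkew (parity X) (-contr hW) := fun a b => by
    simp only [end_neg_apply, contr_skew hW a b]; noncomm_ring
  have : deg X * contr hW - contr hW * deg X = -contr hW :=
    isSkew_ext (deg_skew.bracket (contr_skew hW) deg_parity) h2 (by simp) (by simp)
      (by simp [hW.deg])
  have := DFunLike.congr_fun this w
  simp only [end_sub_apply, end_mul_apply, end_neg_apply] at this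
  rw [sub_eq_iff_eq_add] at this
  rw [this]; abel

lemma deg_vert {W : Matrix κ ι (DR X)} (hW : IsVertical W) (w : DR X) :
    deg X (vert hW w) = vert hW (deg X w) := by
  simp only [vert_apply, map_add, deg_d, deg_contr, map_sub]
  abel

/-- Elements anticommuting with all `θ`. -/
def anti (X : Matrix ι κ R) : AddSubgroup (DR X) where
  carrier := {w | ∀ k b, w * θ X k b + θ X k b * w = 0}
  zero_mem' := by simp
  add_mem' {x y} hx hy k b := by
    rw [add_mul, mul_add, add_add_add_comm, hx, hy, add_zero]
  neg_mem' {x} hx k b := by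
    rw [neg_mul, mul_neg, ← neg_add, hx, neg_zero]

/-- The realization data of an even derivation extending a derivation of `R`. -/
lemma data_even {A : Type} [CommRing A] [Algebra A R] (D : Derivation A R R)
    {l' θ' : Matrix κ ι (DR X)} (hl' : ∀ j a, l' j a ∈ Subring.center (DR X))
    (hθ' : ∀ j a, θ' j a ∈ anti X)
    (hl'X : l X * (X.map D).map (algebraMap R (DR X)) + l' * X.map (algebraMap R (DR X)) = 0)
    (hθ'X : θ X * (X.map D).map (algebraMap R (DR X)) + θ' * X.map (algebraMap R (DR X)) = 0) :
    SkewData (RingHom.id (DR X)) (fun r => algebraMap R _ (D r)) l' θ' where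
  σ_r := by simp
  σ_l := by simp
  δ_add := by simp
  δ_mul r s := by simp [Algebra.smul_def]
  δ_comm r w := Algebra.commutes _ _
  l'_comm j a k b := (Subring.mem_center_iff.1 (hl' j a) _).symm
  anti j a k b := by
    have h1 := hθ' j a k b
    have h2 := hθ' k b j a
    simp only [RingHom.id_apply]
    rw [add_comm (θ X k b * _), add_add_add_comm, h1, add_comm (θ X j a * _), h2, add_zero]
  l'_X := hl'X
  θ'_X := hθ'X

end DR

end

/-- A subgroup stable under commuting diagonalizable operators contains the weight components of
its elements. -/
lemma weight_mem {V A : Type} [AddCommGroup V] (h : A → AddMonoid.End V) (p : AddSubgroup V)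
    (hdiv : ∀ k : ℤ, k ≠ 0 → ∀ v, k • v ∈ p → v ∈ p) (hp : ∀ a, ∀ v ∈ p, h a v ∈ p)
    (M : Finset (A → ℤ)) : ∀ u : (A → ℤ) → V, (∀ μ ∈ M, ∀ a, h a (u μ) = μ a • u μ) →
      ∑ μ ∈ M, u μ ∈ p → ∀ μ ∈ M, u μ ∈ p := by
  classical
  induction M using Finset.induction_on with
  | empty => simp
  | insert ν M hν ih =>
    intro u hu hs
    rw [Finset.sum_insert hν] at hs
    have key : ∀ μ ∈ M, u μ ∈ p := by
      intro μ hμ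
      obtain ⟨a, ha⟩ : ∃ a, μ a ≠ ν a := by
        by_contra! hcon
        exact hν (funext hcon ▸ hμ)
      have h1 : ∑ μ ∈ M, (μ a - ν a) • u μ ∈ p := by
        have h2 := sub_mem (hp a _ hs) (zsmul_mem hs (ν a))
        rw [map_add, map_sum, hu ν (Finset.mem_insert_self _ _), smul_add, add_sub_add_left_eq_sub,
          Finset.smul_sum, ← Finset.sum_sub_distrib] at h2
        convert h2 using 1
        refine Finset.sum_congr rfl fun μ hμ => ?_
        rw [hu μ (Finset.mem_insert_of_mem hμ), sub_smul]
      refine hdiv _ (sub_ne_zero.2 ha) _ (ih (fun μ => (μ a - ν a) • u μ) (fun μ hμ b => ?_) h1 μ hμ)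
      rw [map_zsmul, hu μ (Finset.mem_insert_of_mem hμ), smul_comm]
    intro μ hμ
    rcases Finset.mem_insert.1 hμ with rfl | hμ
    · rwa [add_mem_cancel_right (sum_mem key)] at hs
    · exact key μ hμ

/-- The case of a single operator with eigenvalues in `ℕ`. -/
lemma eigen_mem {V : Type} [AddCommGroup V] (h : AddMonoid.End V) (p : AddSubgroup V)
    (hdiv : ∀ k : ℤ, k ≠ 0 → ∀ v, k • v ∈ p → v ∈ p) (hp : ∀ v ∈ p, h v ∈ p)
    (u : ℕ →₀ V) (hu : ∀ k, h (u k) = k • u k) (hs : (u.sum fun _ v => v) ∈ p) (k : ℕ) :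
    u k ∈ p := by
  classical
  let e : ℕ ↪ (Unit → ℤ) := ⟨fun k _ => k, fun a b hab => by simpa using congrFun hab ()⟩
  have he : ∀ k x, e k x = (k : ℤ) := fun _ _ => rfl
  by_cases hk : k ∈ u.support
  · have := weight_mem (fun _ : Unit => h) p hdiv (fun _ => hp) (u.support.map e)
      (fun μ => u (μ ()).toNat) (fun μ hμ a => ?_) (by
        simpa [Finsupp.sum, he] using hs) (e k) (Finset.mem_map_of_mem _ hk)
    · simpa [he] using this
    · obtain ⟨k, -, rfl⟩ := Finset.mem_map.1 hμ
      simpa [he] using hu k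
  · rw [Finsupp.notMem_support_iff.1 hk]
    exact zero_mem _

lemma intCast_smul_cancel {R V : Type} [CommRing R] [Algebra ℚ R] [AddCommGroup V] [Module R V]
    (p : Submodule R V) (k : ℤ) (hk : k ≠ 0) (v : V) (h : k • v ∈ p) : v ∈ p := by
  have : v = algebraMap ℚ R (k : ℚ)⁻¹ • k • v := by
    rw [← Int.cast_smul_eq_zsmul R, smul_smul, ← map_intCast (algebraMap ℚ R), ← map_mul,
      inv_mul_cancel₀ (by exact_mod_cast hk), map_one, one_smul]
  rw [this]
  exact p.smul_mem _ h

section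

variable {R : Type} [CommRing R] {ι κ : Type} [Fintype ι] [DecidableEq κ] {X : Matrix ι κ R}

namespace DR

variable (X) in
/-- Forms of degree `i`. -/
noncomputable def Om (i : ℕ) : Submodule R (DR X) where
  carrier := {w | deg X w = i • w}
  zero_mem' := by simp
  add_mem' {a b} ha hb := by
    simp only [Set.mem_ofPred_eq] at *
    rw [map_add, ha, hb, smul_add]
  smul_mem' r w hw := by
    simp only [Set.mem_ofPred_eq] at *
    rw [deg_smul, hw, smul_comm]

lemma mem_Om {i : ℕ} {w : DR X} : w ∈ Om X i ↔ deg X w = i • w := Iff.rfl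

variable (X) in
/-- Boundaries of degree `i` in the de Rham complex augmented by `R`. -/
noncomputable def Bd : ℕ → Submodule R (DR X)
  | 0 => LinearMap.range (Algebra.linearMap R (DR X))
  | i + 1 =>
    { carrier := {w | ∃ η ∈ Om X i, d X η = w}
      zero_mem' := ⟨0, zero_mem _, map_zero _⟩
      add_mem' := by
        rintro _ _ ⟨a, ha, rfl⟩ ⟨b, hb, rfl⟩
        exact ⟨a + b, add_mem ha hb, map_add _ _ _⟩
      smul_mem' := by
        rintro r _ ⟨a, ha, rfl⟩
        exact ⟨r • a, Submodule.smul_mem _ r ha, d_smul _ _⟩ }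

lemma mem_Bd_zero {w : DR X} : w ∈ Bd X 0 ↔ ∃ r, algebraMap R _ r = w := Iff.rfl

lemma mem_Bd_succ {i : ℕ} {w : DR X} : w ∈ Bd X (i + 1) ↔ ∃ η ∈ Om X i, d X η = w := Iff.rfl

lemma Bd_le_Om (i : ℕ) : Bd X i ≤ Om X i := by
  intro w hw
  cases i with
  | zero =>
    obtain ⟨r, rfl⟩ := mem_Bd_zero.1 hw
    simp [mem_Om]
  | succ i =>
    obtain ⟨η, hη, rfl⟩ := mem_Bd_succ.1 hw
    rw [mem_Om, deg_d, mem_Om.1 hη, map_nsmul, succ_nsmul]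

lemma d_of_mem_Bd {i : ℕ} {w : DR X} (hw : w ∈ Bd X i) : d X w = 0 := by
  cases i with
  | zero =>
    obtain ⟨r, rfl⟩ := mem_Bd_zero.1 hw
    simp
  | succ i =>
    obtain ⟨η, hη, rfl⟩ := mem_Bd_succ.1 hw
    exact d_d η

variable (X) in
/-- The augmented de Rham complex is exact in degree `i`. -/
def ExactAt (i : ℕ) : Prop := ∀ w ∈ Om X i, d X w = 0 → w ∈ Bd X i

lemma one_mem_Om : (1 : DR X) ∈ Om X 0 := by
  rw [mem_Om, ← map_one (algebraMap R (DR X)), deg_algebraMap, zero_smul]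

lemma mul_mem_Om {i k : ℕ} {a b : DR X} (ha : a ∈ Om X i) (hb : b ∈ Om X k) :
    a * b ∈ Om X (i + k) := by
  rw [mem_Om] at *
  rw [deg_mul, ha, hb, add_smul, smul_mul_assoc, mul_smul_comm]

lemma iSup_Om : (⨆ i, Om X i) = ⊤ := by
  have hmul : (⨆ i, Om X i) * (⨆ i, Om X i) ≤ ⨆ i, Om X i := by
    rw [Submodule.iSup_mul]
    refine iSup_le fun i => ?_
    rw [Submodule.mul_iSup]
    refine iSup_le fun k => ?_
    refine Submodule.mul_le.2 fun a ha b hb => ?_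
    exact Submodule.mem_iSup_of_mem (i + k) (mul_mem_Om ha hb)
  refine Submodule.eq_top_iff'.2 fun w => ?_
  induction w using DR.induction with
  | hr r => exact Submodule.mem_iSup_of_mem 0 (by simp [mem_Om])
  | hl j a => exact Submodule.mem_iSup_of_mem 0 (by simp [mem_Om])
  | hθ j a => exact Submodule.mem_iSup_of_mem 1 (by simp [mem_Om])
  | hadd a b ha hb => exact add_mem ha hb
  | hmul a b ha hb => exact hmul (Submodule.mul_mem_mul ha hb)

/-- There are no forms of degree `-1`. -/
lemma eq_zero_of_deg_neg [Algebra ℚ R] {w : DR X} (hw : deg X w = -w) : w = 0 := by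
  obtain ⟨u, hu, hs⟩ := (Submodule.mem_iSup_iff_exists_finsupp _ _).1
    ((iSup_Om (X := X) ▸ Submodule.mem_top : w ∈ ⨆ i, Om X i))
  let p : AddSubgroup (DR X) := (deg X + 1 : AddMonoid.End (DR X)).ker
  have hp : ∀ v, v ∈ p ↔ deg X v = -v := fun v => by
    change deg X v + v = 0 ↔ _
    rw [eq_neg_iff_add_eq_zero]
  have hdiv : ∀ k : ℤ, k ≠ 0 → ∀ v, k • v ∈ p → v ∈ p := by
    intro k hk v hv
    rw [hp] at *
    rw [map_zsmul, ← smul_neg] at hv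
    have := intCast_smul_cancel (⊥ : Submodule R (DR X)) k hk (deg X v - -v) (by
      rw [smul_sub, hv, sub_self]; simp)
    exact sub_eq_zero.1 (by simpa using this)
  have := eigen_mem (deg X) p hdiv (fun v hv => by
    rw [hp] at *; rw [hv, map_neg, hv]) u hu (by rwa [hs, hp])
  rw [← hs]
  refine Finset.sum_eq_zero fun k _ => ?_
  have h1 := (hp _).1 (this k)
  have h2 : deg X (u k) = k • u k := hu k
  have h3 : ((k : ℤ) + 1) • u k = 0 := by
    rw [add_smul, one_smul, natCast_zsmul, ← h2, h1, neg_add_cancel]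
  have := intCast_smul_cancel (⊥ : Submodule R (DR X)) ((k : ℤ) + 1) (by omega) (u k) (by
    rw [h3]; simp)
  simpa using this

section Morphism

variable {R' : Type} [CommRing R'] {ι' κ' : Type} [Fintype ι'] [DecidableEq κ']
  {Y : Matrix ι' κ' R'}

/-- Morphisms of differential graded algebras. -/
structure IsDG (f : R →+* R') (p : DR X →+* DR Y) : Prop where
  algebraMap : ∀ r, p (algebraMap R _ r) = algebraMap R' _ (f r)
  d : ∀ w, p (d X w) = d Y (p w)
  deg : ∀ w, p (deg X w) = deg Y (p w)
  parity : ∀ w, p (parity X w) = parity Y (p w)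

lemma d_mul_of_center {c : DR X} (hc : c ∈ Subring.center (DR X)) (hp : parity X c = c)
    (w : DR X) : d X c * w = parity X w * d X c := by
  have h1 := d_mul c w
  rw [← Subring.mem_center_iff.1 hc w, d_mul, hp, ← Subring.mem_center_iff.1 hc (d X w),
    add_comm] at h1
  exact (add_right_cancel h1).symm

/-- A left inverse of `X` of degree zero over another de Rham algebra. -/
structure IsInverse (f : R →+* R') (l' : Matrix κ ι (DR Y)) : Prop where
  center : ∀ j a, l' j a ∈ Subring.center (DR Y)
  deg : ∀ j a, deg Y (l' j a) = 0
  parity : ∀ j a, parity Y (l' j a) = l' j a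
  mul_X : l' * X.map ((algebraMap R' (DR Y)).comp f) = 1

lemma realizes_of_isInverse {f : R →+* R'} {l' : Matrix κ ι (DR Y)} (h : IsInverse (X := X) f l') :
    Realizes X ((algebraMap R' (DR Y)).comp f) l' (l'.map (DR.d Y)) where
  comm_l r j a := Algebra.commutes (f r) (l' j a)
  comm_θ r j a := Algebra.commutes (f r) (DR.d Y (l' j a))
  l_l j a k b := (Subring.mem_center_iff.1 (h.center j a) _).symm
  l_θ j a k b := (Subring.mem_center_iff.1 (h.center j a) _).symm
  θ_θ j a k b := by
    rw [Matrix.map_apply, Matrix.map_apply, d_mul_of_center (h.center j a) (h.parity j a)]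
    have h1 := d_parity (l' k b)
    rw [h.parity] at h1
    rw [eq_neg_iff_add_eq_zero] at h1
    rw [← add_mul, add_comm, h1, zero_mul]
  l_X := h.mul_X
  θ_X := by
    refine Matrix.ext fun j k => ?_
    have h1 := congrArg (DR.d Y) (congrFun (congrFun h.mul_X j) k)
    have h2 : DR.d Y ((1 : Matrix κ κ (DR Y)) j k) = 0 := by
      have h3 : DR.d Y 1 = 0 := by rw [← map_one (algebraMap R' (DR Y)), d_algebraMap]
      by_cases hjk : j = k <;> simp [Matrix.one_apply, hjk, h3]
    rw [h2, Matrix.mul_apply, map_sum] at h1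
    rw [Matrix.mul_apply, Matrix.zero_apply, ← h1]
    refine Finset.sum_congr rfl fun a _ => ?_
    simp [d_mul]

lemma exists_isDG_of_isInverse {f : R →+* R'} {l' : Matrix κ ι (DR Y)}
    (h : IsInverse (X := X) f l') :
    ∃ p : DR X →+* DR Y, IsDG f p ∧ ∀ j a, p (l X j a) = l' j a := by
  let p := lift (realizes_of_isInverse h)
  have hr : ∀ r, p (algebraMap R _ r) = algebraMap R' _ (f r) := fun r => lift_algebraMap _ _
  have hl : ∀ j a, p (l X j a) = l' j a := lift_l (realizes_of_isInverse h)
  have hθ : ∀ j a, p (θ X j a) = d Y (l' j a) := lift_θ (realizes_of_isInverse h)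
  have hpar : ∀ w, p (parity X w) = parity Y (p w) := by
    intro w
    induction w using DR.induction with
    | hr r => simp [hr]
    | hl j a => simp [hl, h.parity]
    | hθ j a =>
      have := d_parity (l' j a)
      rw [h.parity] at this
      rw [parity_θ, map_neg, hθ]
      exact neg_eq_iff_eq_neg.2 this
    | hadd a b ha hb => simp [ha, hb]
    | hmul a b ha hb => simp [ha, hb]
  refine ⟨p, ⟨hr, fun w => ?_, fun w => ?_, hpar⟩, hl⟩
  · induction w using DR.induction with
    | hr r => simp [hr]
    | hl j a => simp [hl, hθ]
    | hθ j a => simp [hθ, d_d]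
    | hadd a b ha hb => simp [ha, hb]
    | hmul a b ha hb => simp [ha, hb, d_mul, hpar]
  · induction w using DR.induction with
    | hr r => simp [hr]
    | hl j a => simp [hl, h.deg]
    | hθ j a => simp [hθ, deg_d, h.deg]
    | hadd a b ha hb => simp [ha, hb]
    | hmul a b ha hb => simp [ha, hb, deg_mul]

lemma IsDG.smul {f : R →+* R'} {p : DR X →+* DR Y} (h : IsDG f p) (r : R) (w : DR X) :
    p (r • w) = f r • p w := by
  rw [Algebra.smul_def, map_mul, h.algebraMap, Algebra.smul_def]

lemma IsDG.mem_Om {f : R →+* R'} {p : DR X →+* DR Y} (h : IsDG f p) {i : ℕ} {w : DR X}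
    (hw : w ∈ Om X i) : p w ∈ Om Y i := by
  rw [DR.mem_Om, ← h.deg, DR.mem_Om.1 hw, map_nsmul]

lemma IsDG.mem_Bd {f : R →+* R'} {p : DR X →+* DR Y} (h : IsDG f p) {i : ℕ} {w : DR X}
    (hw : w ∈ Bd X i) : p w ∈ Bd Y i := by
  cases i with
  | zero =>
    obtain ⟨r, rfl⟩ := mem_Bd_zero.1 hw
    exact mem_Bd_zero.2 ⟨f r, (h.algebraMap r).symm⟩
  | succ i =>
    obtain ⟨η, hη, rfl⟩ := mem_Bd_succ.1 hw
    exact mem_Bd_succ.2 ⟨p η, h.mem_Om hη, (h.d η).symm⟩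

end Morphism

/-- The difference of the universal left inverse and its image under a retraction. -/
noncomputable def displacement (φ : DR X →+* DR X) : Matrix κ ι (DR X) :=
  fun j a => l X j a - φ (l X j a)

lemma isVertical_displacement {φ : DR X →+* DR X} (hφ : IsDG (RingHom.id R) φ)
    (hc : ∀ j a, φ (l X j a) ∈ Subring.center (DR X)) : IsVertical (displacement φ) where
  center j a := sub_mem (l_mem_center j a) (hc j a)
  deg j a := by simp [displacement, ← hφ.deg]
  parity j a := by simp [displacement, ← hφ.parity]
  mul_X := by
    refine Matrix.ext fun j k => ?_
    have h1 := congrFun (congrFun (realizes X).l_X j) k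
    have h2 := congrArg φ h1
    have h3 : φ ((1 : Matrix κ κ (DR X)) j k) = (1 : Matrix κ κ (DR X)) j k := by
      by_cases hjk : j = k <;> simp [Matrix.one_apply, hjk]
    rw [h3, ← h1] at h2
    simp only [Matrix.mul_apply, Matrix.map_apply, map_sum, map_mul, hφ.algebraMap,
      RingHom.id_apply] at h2
    simp [Matrix.mul_apply, displacement, sub_mul, h2]

/-- A closed form is homologous to its image under a contraction. -/
theorem sub_mem_Bd_of_contraction [Algebra ℚ R] {φ : DR X →+* DR X}
    (hφ : IsDG (RingHom.id R) φ) (hc : ∀ j a, φ (l X j a) ∈ Subring.center (DR X))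
    (hidem : ∀ j a, φ (φ (l X j a)) = φ (l X j a))
    (hvert : ∀ j a, vert (isVertical_displacement hφ hc) (φ (l X j a)) = 0)
    {i : ℕ} {w : DR X} (hw : w ∈ Om X i) (hd : d X w = 0) : w - φ w ∈ Bd X i := by
  set hW := isVertical_displacement hφ hc
  let e := vert hW
  let Q : ℕ → Submodule R (DR X) := fun k =>
    { carrier := {w | e w = k • w ∧ φ w = if k = 0 then w else 0}
      zero_mem' := by simp
      add_mem' := by
        rintro a b ⟨h1, h2⟩ ⟨h3, h4⟩
        refine ⟨by rw [map_add, h1, h3, smul_add], ?_⟩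
        rw [map_add, h2, h4]
        split_ifs <;> simp
      smul_mem' := by
        rintro r a ⟨h1, h2⟩
        refine ⟨by rw [vert_smul, h1, smul_comm], ?_⟩
        rw [hφ.smul, h2]
        split_ifs <;> simp }
  have hQ : ∀ k w, w ∈ Q k ↔ e w = k • w ∧ φ w = if k = 0 then w else 0 := fun _ _ => Iff.rfl
  have hmul : (⨆ i, Q i) * (⨆ i, Q i) ≤ ⨆ i, Q i := by
    rw [Submodule.iSup_mul]
    refine iSup_le fun i => ?_
    rw [Submodule.mul_iSup]
    refine iSup_le fun k => ?_
    refine Submodule.mul_le.2 fun a ha b hb => ?_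
    refine Submodule.mem_iSup_of_mem (i + k) ?_
    rw [hQ] at *
    refine ⟨?_, ?_⟩
    · rw [vert_skew hW a b, ha.1, hb.1, add_smul, smul_mul_assoc, id, mul_smul_comm]
    · rw [map_mul, ha.2, hb.2]
      by_cases hi : i = 0 <;> by_cases hk : k = 0 <;> simp [hi, hk]
  have hφl0 : ∀ j a, φ (l X j a) ∈ Q 0 := fun j a => by
    rw [hQ]; exact ⟨by rw [zero_smul]; exact hvert j a, by simp [hidem]⟩
  have hl1 : ∀ j a, l X j a - φ (l X j a) ∈ Q 1 := fun j a => by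
    rw [hQ]
    refine ⟨?_, by simp [hidem]⟩
    rw [map_sub]
    change vert hW _ - vert hW _ = _
    rw [hvert, vert_l, sub_zero, one_smul]
    rfl
  have hdQ : ∀ k w, w ∈ Q k → d X w ∈ Q k := fun k w hw => by
    rw [hQ] at *
    refine ⟨?_, ?_⟩
    · change vert hW _ = _
      rw [← d_vert, ← map_nsmul, ← hw.1]
    · rw [hφ.d, hw.2]; split_ifs <;> simp
  have htop : ∀ w, w ∈ ⨆ k, Q k := by
    intro w
    induction w using DR.induction with
    | hr r =>
      refine Submodule.mem_iSup_of_mem 0 ?_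
      rw [hQ]
      exact ⟨by rw [zero_smul]; exact vert_algebraMap _ _, by simp [hφ.algebraMap]⟩
    | hl j a =>
      rw [← sub_add_cancel (l X j a) (φ (l X j a))]
      exact add_mem (Submodule.mem_iSup_of_mem 1 (hl1 j a))
        (Submodule.mem_iSup_of_mem 0 (hφl0 j a))
    | hθ j a =>
      rw [← d_l, ← sub_add_cancel (l X j a) (φ (l X j a)), map_add]
      exact add_mem (Submodule.mem_iSup_of_mem 1 (hdQ _ _ (hl1 j a)))
        (Submodule.mem_iSup_of_mem 0 (hdQ _ _ (hφl0 j a)))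
    | hadd a b ha hb => exact add_mem ha hb
    | hmul a b ha hb => exact hmul (Submodule.mul_mem_mul ha hb)
  obtain ⟨u, hu, hs⟩ := (Submodule.mem_iSup_iff_exists_finsupp _ _).1 (htop w)
  let p : Submodule R (DR X) :=
    { carrier := {v | v ∈ Om X i ∧ d X v = 0}
      zero_mem' := ⟨zero_mem _, map_zero _⟩
      add_mem' := fun ha hb => ⟨add_mem ha.1 hb.1, by rw [map_add, ha.2, hb.2, add_zero]⟩
      smul_mem' := fun r a ha => ⟨Submodule.smul_mem _ r ha.1, by rw [d_smul, ha.2, smul_zero]⟩ }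
  have hp := eigen_mem e p.toAddSubgroup (intCast_smul_cancel p) (fun v hv => ⟨by
    rw [mem_Om]
    change deg X (vert hW _) = _ • vert hW _
    rw [deg_vert, mem_Om.1 hv.1, map_nsmul], by
    change d X (vert hW _) = _
    rw [d_vert, hv.2, map_zero]⟩) u (fun k => (hu k).1) (by rw [hs]; exact ⟨hw, hd⟩)
  have hexact : ∀ k, u k - φ (u k) ∈ Bd X i := by
    intro k
    rw [((hQ _ _).1 (hu k)).2]
    split_ifs with hk
    · simp
    · rw [sub_zero]
      have h1 : k • u k = d X (contr hW (u k)) := by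
        rw [← ((hQ _ _).1 (hu k)).1]
        change vert hW _ = _
        rw [vert_apply, (hp k).2, map_zero, add_zero]
      refine intCast_smul_cancel _ k (by exact_mod_cast hk) _ ?_
      rw [natCast_zsmul, h1]
      have h2 : deg X (contr hW (u k)) = (i : ℤ) • contr hW (u k) - contr hW (u k) := by
        rw [deg_contr, mem_Om.1 (hp k).1, map_nsmul, natCast_zsmul]
      cases i with
      | zero =>
        rw [eq_zero_of_deg_neg (w := contr hW (u k)) (by simpa using h2), map_zero]
        exact zero_mem _
      | succ i =>
        refine mem_Bd_succ.2 ⟨_, ?_, rfl⟩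
        rw [mem_Om, h2]
        simp [add_smul]
  rw [← hs, Finsupp.sum, map_sum, ← Finset.sum_sub_distrib]
  exact sum_mem fun k _ => hexact k

end DR

end

namespace DR

section Schur

variable {R : Type} [CommRing R] {ι κ ι' κ' : Type} [Fintype ι] [DecidableEq κ] [Fintype ι']
  [DecidableEq κ'] {X : Matrix ι κ R} {Y : Matrix ι' κ' R}

lemma isSkew_map_mul {p q s : Type} [Fintype q] {F : AddMonoid.End (DR X)} (hF : IsSkew id F)
    (A : Matrix p q (DR X)) (B : Matrix q s (DR X)) :
    (A * B).map F = A.map F * B + A * B.map F := by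
  refine Matrix.ext fun i j => ?_
  simp only [Matrix.map_apply, Matrix.add_apply, Matrix.mul_apply, map_sum, hF _ _,
    Finset.sum_add_distrib, id]

lemma isSkew_map_affine {p q r s : Type} [Fintype q] [Fintype r] {F : AddMonoid.End (DR X)}
    (hF : IsSkew id F) (h0 : ∀ a, F (algebraMap R (DR X) a) = 0) (A : Matrix p q R)
    (M : Matrix q r (DR X)) (B : Matrix r s R) (C : Matrix p s R) :
    (A.map (algebraMap R (DR X)) * M * B.map (algebraMap R (DR X)) +
      C.map (algebraMap R (DR X))).map F =
    A.map (algebraMap R (DR X)) * M.map F * B.map (algebraMap R (DR X)) := by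
  have h : ∀ {u v : Type} (A : Matrix u v R), (A.map (algebraMap R (DR X))).map F = 0 :=
    fun A => Matrix.ext fun i j => h0 _
  rw [Matrix.map_add _ (map_add _), isSkew_map_mul hF, isSkew_map_mul hF, h, h, h]
  simp only [Matrix.zero_mul, Matrix.mul_zero, zero_add, add_zero]

lemma map_scalar {T : Type} [Ring T] {g : DR X →+* T} {f : R →+* T}
    (h : ∀ r, g (algebraMap R _ r) = f r) {p q : Type} (A : Matrix p q R) :
    (A.map (algebraMap R (DR X))).map g = A.map f :=
  Matrix.ext fun _ _ => h _

lemma map_affine {T : Type} [Ring T] {g : DR X →+* T} {f : R →+* T}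
    (h : ∀ r, g (algebraMap R _ r) = f r) {p q r s : Type} [Fintype q] [Fintype r]
    (A : Matrix p q R) (M : Matrix q r (DR X)) (B : Matrix r s R) (C : Matrix p s R) :
    (A.map (algebraMap R (DR X)) * M * B.map (algebraMap R (DR X)) +
      C.map (algebraMap R (DR X))).map g = A.map f * M.map g * B.map f + C.map f := by
  rw [Matrix.map_add _ (map_add _), Matrix.map_mul, Matrix.map_mul, map_scalar h, map_scalar h,
    map_scalar h]

lemma isInverse_affine (A : Matrix κ κ' R) (B : Matrix ι' ι R) (C : Matrix κ ι R)
    (J : Matrix κ' κ R) [Fintype κ'] (hBX : B * X = Y * J) (hCX : A * J + C * X = 1) :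
    IsInverse (X := X) (RingHom.id R) (A.map (algebraMap R (DR Y)) * l Y *
      B.map (algebraMap R (DR Y)) + C.map (algebraMap R (DR Y))) := by
  refine ⟨fun j a => ?_, fun j a => ?_, fun j a => ?_, ?_⟩
  · refine add_mem (mul_mem_center (mul_mem_center ?_ l_mem_center) ?_ j a) ?_
    all_goals intros; exact algebraMap_mem_center _
  · have h := isSkew_map_affine (deg_skew (X := Y)) deg_algebraMap A (l Y) B C
    have h2 : (l Y).map (deg Y) = 0 := Matrix.ext fun j a => deg_l j a
    rw [h2, Matrix.mul_zero, Matrix.zero_mul] at h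
    exact congrFun (congrFun h j) a
  · have h := map_affine (parity_algebraMap (X := Y)) A (l Y) B C
    have h2 : (l Y).map (parity Y) = l Y := Matrix.ext fun j a => parity_l j a
    rw [h2] at h
    exact congrFun (congrFun h j) a
  · rw [RingHom.comp_id, Matrix.add_mul, Matrix.mul_assoc _ _ (X.map _), ← Matrix.map_mul, hBX,
      Matrix.map_mul, ← Matrix.mul_assoc, Matrix.mul_assoc _ (l Y), (realizes Y).l_X,
      Matrix.mul_one, ← Matrix.map_mul, ← Matrix.map_mul, ← Matrix.map_add _ (map_add _), hCX,
      Matrix.map_one _ (map_zero _) (map_one _)]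

/-- Exactness transfers along a split elimination of rows and columns. -/
theorem ExactAt.of_elimination [Algebra ℚ R] [Fintype κ] [Fintype κ'] [DecidableEq ι']
    (C : Matrix κ κ' R) (D : Matrix ι' ι R)
    (J : Matrix κ' κ R) (J' : Matrix ι ι' R) (G : Matrix κ ι R) (hDX : D * X = Y * J)
    (hXC : X * C = J' * Y) (hJC : J * C = 1) (hDJ : D * J' = 1) (hG : J * G * J' = 0)
    (hCJ : C * J + G * X = 1) {i : ℕ} (hY : ExactAt Y i) : ExactAt X i := by
  obtain ⟨p, hp, hpl⟩ := exists_isDG_of_isInverse (isInverse_affine C D G J hDX hCJ)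
  obtain ⟨q, hq, hql⟩ := exists_isDG_of_isInverse
    (isInverse_affine (X := Y) (Y := X) J J' 0 C hXC.symm (by rw [hJC, Matrix.zero_mul, add_zero]))
  set s := algebraMap R (DR X)
  have hφ : IsDG (RingHom.id R) (q.comp p) :=
    ⟨fun r => by simp [hp.algebraMap, hq.algebraMap], fun w => by simp [hp.d, hq.d],
      fun w => by simp [hp.deg, hq.deg], fun w => by simp [hp.parity, hq.parity]⟩
  have hJl : (l Y).map q = J.map s * l X * J'.map s := by
    refine Matrix.ext fun j a => (hql j a).trans ?_
    simp [s]
  have hφl : (l X).map (q.comp p) = (C * J).map s * l X * (J' * D).map s + G.map s := by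
    have h1 : (l X).map (q.comp p) = ((l X).map p).map q := rfl
    have h2 : (l X).map p = _ := Matrix.ext hpl
    rw [h1, h2, map_affine (f := s) hq.algebraMap, hJl]
    simp only [Matrix.map_mul, Matrix.mul_assoc]
  have hcomm : J.map s * (G.map s) * J'.map s = 0 := by
    rw [← Matrix.map_mul, ← Matrix.map_mul, hG, Matrix.map_zero _ (map_zero _)]
  have hJΦJ : J.map s * (l X).map (q.comp p) * J'.map s = J.map s * l X * J'.map s := by
    rw [hφl, Matrix.mul_add, Matrix.add_mul, hcomm, add_zero]
    simp only [← Matrix.mul_assoc, ← Matrix.map_mul]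
    simp only [Matrix.mul_assoc _ _ (J'.map s), ← Matrix.map_mul]
    rw [hJC, Matrix.one_mul, Matrix.mul_assoc J', hDJ, Matrix.mul_one,
      Matrix.mul_assoc]
  have hc : ∀ j a, (q.comp p) (l X j a) ∈ Subring.center (DR X) := fun j a => by
    have := congrFun (congrFun hφl j) a
    rw [← Matrix.map_apply (f := q.comp p) (M := l X), this]
    refine add_mem (mul_mem_center (mul_mem_center ?_ l_mem_center) ?_ j a) ?_
    all_goals intros; exact algebraMap_mem_center _
  have key : ∀ M : Matrix κ ι (DR X), J.map s * M * J'.map s = J.map s * l X * J'.map s →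
      (C * J).map s * M * (J' * D).map s = (C * J).map s * l X * (J' * D).map s := by
    intro M hM
    have := congrArg (fun N => C.map s * N * D.map s) hM
    simpa only [Matrix.map_mul, Matrix.mul_assoc] using this
  intro w hw hd
  rw [← sub_add_cancel w ((q.comp p) w)]
  refine add_mem (sub_mem_Bd_of_contraction hφ hc ?_ ?_ hw hd) (hq.mem_Bd (hY _ (hp.mem_Om hw) ?_))
  · intro j a
    have : ((l X).map (q.comp p)).map (q.comp p) = (l X).map (q.comp p) := by
      conv_lhs => rw [hφl]
      rw [map_affine (f := s) hφ.algebraMap, key _ hJΦJ, hφl]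
    exact congrFun (congrFun this j) a
  · intro j a
    have : ((l X).map (q.comp p)).map (vert (isVertical_displacement hφ hc)) = 0 := by
      rw [hφl, isSkew_map_affine (vert_skew _) (vert_algebraMap _)]
      have h1 : (l X).map (vert (isVertical_displacement hφ hc)) =
          l X - (l X).map (q.comp p) := Matrix.ext fun j a => vert_l _ j a
      rw [h1, Matrix.mul_sub, Matrix.sub_mul, key _ hJΦJ, sub_self]
    exact congrFun (congrFun this j) a
  · rw [← hp.d, hd, map_zero]

/-- A matrix without columns has an exact de Rham complex. -/
lemma exactAt_of_isEmpty [Algebra ℚ R] [IsEmpty κ] (i : ℕ) : ExactAt X i := by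
  have hrange : ∀ w : DR X, ∃ r, algebraMap R (DR X) r = w := by
    intro w
    induction w using DR.induction with
    | hr r => exact ⟨r, rfl⟩
    | hl j a => exact isEmptyElim j
    | hθ j a => exact isEmptyElim j
    | hadd a b ha hb =>
      obtain ⟨r, rfl⟩ := ha
      obtain ⟨s, rfl⟩ := hb
      exact ⟨r + s, map_add _ _ _⟩
    | hmul a b ha hb =>
      obtain ⟨r, rfl⟩ := ha
      obtain ⟨s, rfl⟩ := hb
      exact ⟨r * s, map_mul _ _ _⟩
  intro w hw _
  obtain ⟨r, rfl⟩ := hrange w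
  rw [mem_Om, deg_algebraMap] at hw
  cases i with
  | zero => exact mem_Bd_zero.2 ⟨r, rfl⟩
  | succ i =>
    have := intCast_smul_cancel (⊥ : Submodule R (DR X)) ((i + 1 : ℕ) : ℤ) (by omega)
      (algebraMap R (DR X) r) (by rw [natCast_zsmul, ← hw]; simp)
    rw [(Submodule.mem_bot R).1 this]
    exact zero_mem _

/-- A matrix with a left inverse has an exact de Rham complex. -/
lemma exactAt_of_left_inverse [Algebra ℚ R] [Fintype κ] (G : Matrix κ ι R) (h : G * X = 1)
    (i : ℕ) : ExactAt X i := by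
  refine ExactAt.of_elimination (Y := (0 : Matrix Empty Empty R)) 0 0 0 0 G ?_ ?_ ?_ ?_ ?_ ?_
    (exactAt_of_isEmpty i)
  · simp
  · simp
  · exact Matrix.ext fun i => isEmptyElim i
  · exact Matrix.ext fun i => isEmptyElim i
  · simp
  · simpa using h

/-- Scalars embed when a left inverse exists. -/
lemma algebraMap_injective_of_left_inverse (G : Matrix κ ι R) (h : G * X = 1) :
    Function.Injective (algebraMap R (DR X)) := by
  have hG : Realizes X (RingHom.id R) G 0 :=
    { comm_l := fun _ _ _ => mul_comm _ _
      comm_θ := fun _ _ _ => mul_comm _ _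
      l_l := fun _ _ _ _ => mul_comm _ _
      l_θ := fun _ _ _ _ => mul_comm _ _
      θ_θ := fun _ _ _ _ => by simp
      l_X := by simpa using h
      θ_X := by simp }
  exact fun a b hab => by simpa using congrArg (lift hG) hab

/-- The Schur complement of an invertible entry. -/
def schur (X : Matrix ι κ R) (y : R) (a₀ : ι) (b₀ : κ) :
    Matrix {a // a ≠ a₀} {b // b ≠ b₀} R :=
  fun a b => X a b - X a b₀ * y * X a₀ b

/-- Exactness for a matrix with an invertible entry follows from that of its Schur complement. -/
lemma ExactAt.of_schur [Algebra ℚ R] [DecidableEq ι] [Fintype κ] {y : R} {a₀ : ι} {b₀ : κ}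
    (hy : X a₀ b₀ * y = 1) {i : ℕ} (h : ExactAt (schur X y a₀ b₀) i) : ExactAt X i := by
  have hy' : y * X a₀ b₀ = 1 := by rw [mul_comm, hy]
  refine ExactAt.of_elimination (Y := schur X y a₀ b₀)
    (Matrix.of fun b b' => if b = b₀ then -(y * X a₀ b') else if b = b' then 1 else 0)
    (Matrix.of fun a' a => if a = a₀ then -(X a' b₀ * y) else if a = a' then 1 else 0)
    (Matrix.of fun b' b => if b = b' then 1 else 0)
    (Matrix.of fun a a' => if a = a' then 1 else 0)
    (Matrix.of fun b a => if b = b₀ ∧ a = a₀ then y else 0) ?_ ?_ ?_ ?_ ?_ ?_ h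
  all_goals
    have ha : ∀ a : {a // a ≠ a₀}, (a : ι) ≠ a₀ := fun a => a.2
    have ha' : ∀ a : {a // a ≠ a₀}, a₀ ≠ a := fun a => a.2.symm
    have hb₁ : ∀ a : {a // a ≠ b₀}, (a : κ) ≠ b₀ := fun a => a.2
    have hb₁' : ∀ a : {a // a ≠ b₀}, b₀ ≠ a := fun a => a.2.symm
    refine Matrix.ext fun a b => ?_
  · rcases eq_or_ne b b₀ with rfl | hb
    · simp [Matrix.mul_apply, schur, ha, hb₁', mul_assoc, Subtype.coe_inj, Fintype.sum_eq_add_sum_subtype_ne _ a₀, hy']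
    · lift b to {b // b ≠ b₀} using hb
      simp [Matrix.mul_apply, schur, ha, mul_assoc, Subtype.coe_inj, Fintype.sum_eq_add_sum_subtype_ne _ a₀]
      ring
  · rcases eq_or_ne a a₀ with rfl | hb
    · simp [Matrix.mul_apply, schur, ha', hb₁, ← mul_assoc, Subtype.coe_inj, Fintype.sum_eq_add_sum_subtype_ne _ b₀, hy]
    · lift a to {b // b ≠ a₀} using hb
      simp [Matrix.mul_apply, schur, hb₁, mul_assoc, Subtype.coe_inj, Fintype.sum_eq_add_sum_subtype_ne _ b₀]
      ring
  · simp [Matrix.mul_apply, hb₁, hb₁', Matrix.one_apply, Subtype.coe_inj, Fintype.sum_eq_add_sum_subtype_ne _ b₀]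
    exact if_congr eq_comm rfl rfl
  · simp [Matrix.mul_apply, ha, ha', Matrix.one_apply, Subtype.coe_inj, Fintype.sum_eq_add_sum_subtype_ne _ a₀]
    exact if_congr eq_comm rfl rfl
  · simp [Matrix.mul_apply, ha, ha', Fintype.sum_eq_add_sum_subtype_ne _ a₀]
  · rcases eq_or_ne b b₀ with rfl | hb
    · simp [Matrix.mul_apply, hb₁', ha, Matrix.one_apply, Fintype.sum_eq_add_sum_subtype_ne _ a₀, hy']
    · lift b to {b // b ≠ b₀} using hb
      rcases eq_or_ne a b₀ with rfl | ha₁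
      · simp [Matrix.mul_apply, ha, hb₁', Subtype.coe_inj, Fintype.sum_eq_add_sum_subtype_ne _ a₀]
      · simp [Matrix.mul_apply, ha₁, Matrix.one_apply, Subtype.coe_inj, Fintype.sum_eq_add_sum_subtype_ne _ a₀]

end Schur

end DR

namespace DR

section Localization

variable {R : Type} [CommRing R] {ι κ : Type} [Fintype ι] [DecidableEq κ] (X : Matrix ι κ R)
  (x : R) (R' : Type) [CommRing R'] [Algebra R R']

lemma isInverse_map : IsInverse (X := X) (algebraMap R R') (l (X.map (algebraMap R R'))) where
  center := l_mem_center
  deg := deg_l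
  parity := parity_l
  mul_X := by
    rw [← (realizes (X.map (algebraMap R R'))).l_X, Matrix.map_map]
    rfl

/-- Base change of the de Rham algebra. -/
noncomputable def baseChange : DR X →+* DR (X.map (algebraMap R R')) :=
  (exists_isDG_of_isInverse (isInverse_map X R')).choose

lemma isDG_baseChange : IsDG (algebraMap R R') (baseChange X R') :=
  (exists_isDG_of_isInverse (isInverse_map X R')).choose_spec.1

lemma baseChange_l (j a) : baseChange X R' (l X j a) = l (X.map (algebraMap R R')) j a :=
  (exists_isDG_of_isInverse (isInverse_map X R')).choose_spec.2 j a

lemma baseChange_θ (j a) : baseChange X R' (θ X j a) = θ (X.map (algebraMap R R')) j a := by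
  rw [← d_l, (isDG_baseChange X R').d, baseChange_l, d_l]

open TensorProduct in
lemma realizes_tensor : Realizes (X.map (algebraMap R R'))
    (Algebra.TensorProduct.includeLeftRingHom : R' →+* R' ⊗[R] DR X)
    ((l X).map Algebra.TensorProduct.includeRight)
    ((θ X).map Algebra.TensorProduct.includeRight) where
  comm_l r j a := by simp
  comm_θ r j a := by simp
  l_l j a k b := by simp [(realizes X).l_l j a]
  l_θ j a k b := by simp [(realizes X).l_θ j a]
  θ_θ j a k b := by simp [← TensorProduct.tmul_add, (realizes X).θ_θ j a]
  l_X := by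
    have h : (X.map (algebraMap R R')).map
        (Algebra.TensorProduct.includeLeftRingHom : R' →+* R' ⊗[R] DR X) =
        (X.map (algebraMap R (DR X))).map (Algebra.TensorProduct.includeRight (R := R) (A := R')) :=
      Matrix.ext fun a b => by simp
    rw [h, ← Matrix.map_mul, (realizes X).l_X, Matrix.map_one _ (map_zero _) (map_one _)]
  θ_X := by
    have h : (X.map (algebraMap R R')).map
        (Algebra.TensorProduct.includeLeftRingHom : R' →+* R' ⊗[R] DR X) =
        (X.map (algebraMap R (DR X))).map (Algebra.TensorProduct.includeRight (R := R) (A := R')) :=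
      Matrix.ext fun a b => by simp
    rw [h, ← Matrix.map_mul, (realizes X).θ_X, Matrix.map_zero _ (map_zero _)]

variable [IsLocalization.Away x R']

variable {R' X} in
open TensorProduct in
lemma exists_pow_smul_eq_zero {w : DR X} (hw : baseChange X R' w = 0) : ∃ N : ℕ, x ^ N • w = 0 := by
  have h : ∀ w, lift (realizes_tensor X R') (baseChange X R' w) =
      (Algebra.TensorProduct.includeRight : DR X →ₐ[R] R' ⊗[R] DR X) w := by
    intro w
    induction w using DR.induction with
    | hr r => rw [(isDG_baseChange X R').algebraMap, lift_algebraMap]; simp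
    | hl j a => rw [baseChange_l, lift_l]; rfl
    | hθ j a => rw [baseChange_θ, lift_θ]; rfl
    | hadd a b ha hb => rw [map_add, map_add, ha, hb, map_add]
    | hmul a b ha hb => rw [map_mul, map_mul, ha, hb, map_mul]
  have h1 := h w
  rw [hw, map_zero] at h1
  have h2 : TensorProduct.mk R R' (DR X) 1 w = TensorProduct.mk R R' (DR X) 1 0 := by
    rw [map_zero]; exact h1.symm
  obtain ⟨⟨_, N, rfl⟩, hc⟩ := (IsLocalizedModule.eq_iff_exists (Submonoid.powers x)
    (TensorProduct.mk R R' (DR X) 1)).1 h2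
  exact ⟨N, hc.trans (smul_zero _)⟩

variable {R' X} in
lemma exists_baseChange_eq (w : DR (X.map (algebraMap R R'))) :
    ∃ (N : ℕ) (v : DR X), baseChange X R' v = algebraMap R R' (x ^ N) • w := by
  induction w using DR.induction with
  | hr r =>
    obtain ⟨⟨s, _, N, rfl⟩, h⟩ := IsLocalization.surj (Submonoid.powers x) r
    refine ⟨N, algebraMap R _ s, ?_⟩
    rw [(isDG_baseChange X R').algebraMap, ← h, Algebra.smul_def, mul_comm r, map_mul]
  | hl j a => exact ⟨0, l X j a, by rw [baseChange_l, pow_zero, map_one, one_smul]⟩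
  | hθ j a => exact ⟨0, θ X j a, by rw [baseChange_θ, pow_zero, map_one, one_smul]⟩
  | hadd a b ha hb =>
    obtain ⟨N, v, hv⟩ := ha
    obtain ⟨M, u, hu⟩ := hb
    refine ⟨N + M, x ^ M • v + x ^ N • u, ?_⟩
    rw [map_add, (isDG_baseChange X R').smul, (isDG_baseChange X R').smul, hv, hu, smul_smul,
      smul_smul, smul_add, ← map_mul, ← map_mul, pow_add, mul_comm (x ^ M)]
  | hmul a b ha hb =>
    obtain ⟨N, v, hv⟩ := ha
    obtain ⟨M, u, hu⟩ := hb
    refine ⟨N + M, v * u, ?_⟩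
    rw [map_mul, hv, hu, smul_mul_smul_comm, pow_add, map_mul]

variable {R' X} in
/-- Boundaries may be detected after localization, up to powers of the denominator. -/
theorem exists_pow_smul_mem_Bd {i : ℕ} {w : DR X}
    (hB : baseChange X R' w ∈ Bd (X.map (algebraMap R R')) i) : ∃ N : ℕ, x ^ N • w ∈ Bd X i := by
  have hD := isDG_baseChange X R'
  cases i with
  | zero =>
    obtain ⟨r, hr⟩ := mem_Bd_zero.1 hB
    obtain ⟨⟨s, _, N, rfl⟩, h⟩ := IsLocalization.surj (Submonoid.powers x) r
    have h1 : baseChange X R' (x ^ N • w - algebraMap R _ s) = 0 := by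
      rw [map_sub, hD.smul, ← hr, hD.algebraMap, ← h, Algebra.smul_def, mul_comm r, map_mul,
        sub_self]
    obtain ⟨M, hM⟩ := exists_pow_smul_eq_zero x h1
    refine ⟨M + N, mem_Bd_zero.2 ⟨x ^ M * s, ?_⟩⟩
    rw [smul_sub, sub_eq_zero, smul_smul, ← pow_add] at hM
    rw [hM, map_mul, Algebra.smul_def]
  | succ i =>
    obtain ⟨η', hη', hd⟩ := mem_Bd_succ.1 hB
    obtain ⟨N, η, hη⟩ := exists_baseChange_eq x η'
    have h1 : baseChange X R' (deg X η - i • η) = 0 := by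
      rw [map_sub, map_nsmul, hD.deg, hη, deg_smul, mem_Om.1 hη', smul_comm, sub_self]
    obtain ⟨M, hM⟩ := exists_pow_smul_eq_zero x h1
    have h2 : baseChange X R' (x ^ N • w - d X η) = 0 := by
      rw [map_sub, hD.d, hη, d_smul, hd, hD.smul, sub_self]
    obtain ⟨K, hK⟩ := exists_pow_smul_eq_zero x h2
    refine ⟨M + K + N, mem_Bd_succ.2 ⟨x ^ (M + K) • η, ?_, ?_⟩⟩
    · rw [add_comm M, pow_add, mul_smul]
      refine Submodule.smul_mem _ _ ?_
      rw [mem_Om, deg_smul, ← sub_eq_zero, smul_comm i, ← smul_sub, hM]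
    · rw [d_smul, pow_add _ (M + K) N, mul_smul, eq_comm, ← sub_eq_zero, ← smul_sub, pow_add,
        mul_smul, hK, smul_zero]

end Localization

end DR

section Weyl

variable {ι V : Type} [Fintype ι] [DecidableEq ι] [AddCommGroup V] [Module ℚ V]

/-- The commutation relations of the general linear Lie algebra. -/
def IsGL (E : ι → ι → Module.End ℚ V) : Prop :=
  ∀ a b c d, E a b * E c d - E c d * E a b =
    (if b = c then E a d else 0) - (if a = d then E c b else 0)

/-- Joint eigenvectors of the diagonal operators. -/
def IsWeight (E : ι → ι → Module.End ℚ V) (μ : ι → ℤ) (v : V) : Prop :=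
  ∀ a, E a a v = μ a • v

variable {E : ι → ι → Module.End ℚ V}

lemma exists_weight_decomposition {v : V}
    (hv : v ∈ Submodule.span ℚ {u | ∃ μ, IsWeight E μ u}) :
    ∃ (M : Finset (ι → ℤ)) (u : (ι → ℤ) → V), (∀ μ ∈ M, IsWeight E μ (u μ)) ∧
      ∑ μ ∈ M, u μ = v := by
  let Wt : (ι → ℤ) → Submodule ℚ V := fun μ =>
    { carrier := {u | IsWeight E μ u}
      zero_mem' := fun a => by simp
      add_mem' := fun h1 h2 a => by rw [map_add, h1 a, h2 a, smul_add]
      smul_mem' := fun r u h a => by rw [map_smul, h a, smul_comm] }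
  have h : Submodule.span ℚ {u | ∃ μ, IsWeight E μ u} ≤ ⨆ μ, Wt μ := by
    rw [Submodule.span_le]
    rintro u ⟨μ, hμ⟩
    exact Submodule.mem_iSup_of_mem μ hμ
  obtain ⟨f, hf, hs⟩ := (Submodule.mem_iSup_iff_exists_finsupp _ _).1 (h hv)
  exact ⟨f.support, f, fun μ _ => hf μ, hs⟩

lemma IsGL.casimir_comm (hE : IsGL E) (c d : ι) :
    E c d * (∑ a, ∑ b, E a b * E b a) = (∑ a, ∑ b, E a b * E b a) * E c d := by
  rw [← sub_eq_zero]
  have h : ∀ a b, E c d * (E a b * E b a) - E a b * E b a * E c d =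
      ((if d = a then E c b else 0) - (if c = b then E a d else 0)) * E b a +
      E a b * ((if d = b then E c a else 0) - (if c = a then E b d else 0)) := by
    intro a b
    rw [← hE c d a b, ← hE c d b a]
    noncomm_ring
  simp only [Finset.mul_sum, Finset.sum_mul, ← Finset.sum_sub_distrib, h]
  simp only [sub_mul, mul_sub, Finset.sum_add_distrib, Finset.sum_sub_distrib, ite_mul, mul_ite,
    zero_mul, mul_zero]
  rw [Finset.sum_comm]
  simp

lemma IsGL.isWeight (hE : IsGL E) {μ : ι → ℤ} {v : V} (hv : IsWeight E μ v) {a b : ι} :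
    IsWeight E (μ + Pi.single a 1 - Pi.single b 1) (E a b v) := by
  intro c
  have h := congrArg (fun F => F v) (hE c c a b)
  simp only [LinearMap.sub_apply, Module.End.mul_apply] at h
  rw [hv c, map_zsmul, sub_eq_iff_eq_add] at h
  rw [h]
  simp only [Pi.add_apply, Pi.sub_apply, Pi.single_apply, sub_smul, add_smul, ite_smul]
  rcases eq_or_ne c a with rfl | h1 <;> rcases eq_or_ne c b with rfl | h2
  · simp
  · simp only [h2, if_true, if_false, LinearMap.zero_apply, one_smul, zero_smul]
    abel
  · simp only [h1, if_true, if_false, LinearMap.zero_apply, one_smul, zero_smul]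
    abel
  · simp [h1, h2]

lemma normSq_single {μ : ι → ℤ} {a b : ι} (hab : a ≠ b) (h : μ b ≤ μ a) :
    ∑ c, μ c ^ 2 < ∑ c, (μ + Pi.single a 1 - Pi.single b 1 : ι → ℤ) c ^ 2 := by
  have h1 : ∀ c, (μ + Pi.single a 1 - Pi.single b 1 : ι → ℤ) c ^ 2 =
      μ c ^ 2 + (if c = a then 2 * μ a + 1 else 0) + (if c = b then 1 - 2 * μ b else 0) := by
    intro c
    simp only [Pi.add_apply, Pi.sub_apply, Pi.single_apply]
    by_cases h1 : c = a
    · subst h1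
      simp [hab]; ring
    · by_cases h2 : c = b
      · subst h2
        simp [h1]; ring
      · simp [h1, h2]
  simp only [h1, Finset.sum_add_distrib, Finset.sum_ite_eq', Finset.mem_univ, if_true]
  linarith

lemma IsGL.casimir_of_dominant (hE : IsGL E) {μ : ι → ℤ} {v : V} (hv : IsWeight E μ v)
    (h : ∀ a b, a ≠ b → μ b ≤ μ a → E a b v = 0) :
    (∑ a, ∑ b, E a b * E b a) v =
      (∑ a, ∑ b, (if a = b then μ a ^ 2 else max (μ a - μ b) 0)) • v := by
  simp only [LinearMap.sum_apply, Finset.sum_smul]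
  refine Finset.sum_congr rfl fun a _ => Finset.sum_congr rfl fun b _ => ?_
  rw [Module.End.mul_apply]
  split_ifs with hab
  · subst hab
    rw [hv a, map_zsmul, hv a, smul_smul, sq]
  · rcases le_or_gt (μ a) (μ b) with h1 | h1
    · rw [h b a (Ne.symm hab) h1, map_zero, max_eq_right (by omega), zero_smul]
    · have h2 := congrArg (fun F => F v) (hE a b b a)
      simp only [LinearMap.sub_apply, Module.End.mul_apply, if_true] at h2
      rw [h a b hab h1.le, map_zero, sub_zero, hv a, hv b] at h2
      rw [h2, max_eq_left (by omega), sub_smul]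

/-- The Casimir element detects nonzero weights. -/
lemma IsGL.apply_eq_zero_of_nilpotent (hE : IsGL E)
    (hwt : ∀ v : V, v ∈ Submodule.span ℚ {u | ∃ μ, IsWeight E μ u}) {F : Submodule ℚ V}
    [FiniteDimensional ℚ F] (hF : ∀ a b, ∀ u ∈ F, E a b u ∈ F) {N : ℕ}
    (hN : ∀ u ∈ F, ((∑ a, ∑ b, E a b * E b a) ^ N) u = 0) {u : V} (hu : u ∈ F) (a b : ι) :
    E a b u = 0 := by
  classical
  have hdiv : ∀ p : Submodule ℚ V, ∀ k : ℤ, k ≠ 0 → ∀ v, k • v ∈ p → v ∈ p :=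
    fun p => intCast_smul_cancel p
  -- the set of weights is finite
  let S : Set (ι → ℤ) := {μ | ∃ u ∈ F, u ≠ 0 ∧ IsWeight E μ u}
  have hS : S.Finite := by
    choose w hwF hw0 hw using fun μ : S => μ.2
    have hli : LinearIndependent ℚ fun μ : S => (⟨w μ, hwF μ⟩ : F) := by
      rw [linearIndependent_iff']
      intro s g hg μ hμ
      have h1 : ∑ ν ∈ s.map (Function.Embedding.subtype _),
          (if h : ν ∈ S then g ⟨ν, h⟩ • w ⟨ν, h⟩ else 0) = 0 := by
        rw [Finset.sum_map]
        have := congrArg (F.subtype) hg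
        rw [map_sum, map_zero] at this
        refine Eq.trans ?_ this
        exact Finset.sum_congr rfl fun ν _ => by simp
      have h2 := weight_mem (fun a => (E a a).toAddMonoidHom) (⊥ : Submodule ℚ V).toAddSubgroup
        (hdiv ⊥) (fun a v hv => by
          change E a a v ∈ (⊥ : Submodule ℚ V)
          rw [(Submodule.mem_bot ℚ).1 hv, map_zero]
          exact zero_mem _) _ _ (fun ν hν a => by
          change E a a _ = _
          split_ifs with h
          · rw [map_smul, hw ⟨ν, h⟩ a, smul_comm]
          · simp) (h1 ▸ zero_mem _) μ (Finset.mem_map_of_mem _ hμ)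
      rw [dif_pos μ.2] at h2
      exact (smul_eq_zero.1 ((Submodule.mem_bot ℚ).1 h2)).resolve_right (hw0 μ)
    have := hli.finite_of_isNoetherian
    exact Set.toFinite S
  -- all weights vanish
  have hzero : ∀ μ ∈ S, μ = 0 := by
    intro μ₀ hμ₀
    obtain ⟨μ, ⟨u, huF, hu0, hu⟩, hmax⟩ :=
      hS.exists_maximalFor (fun μ => ∑ c, μ c ^ 2) S ⟨μ₀, hμ₀⟩
    have hdom : ∀ a b, a ≠ b → μ b ≤ μ a → E a b u = 0 := by
      intro a b hab h
      by_contra hne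
      have hmem : (μ + Pi.single a 1 - Pi.single b 1 : ι → ℤ) ∈ S :=
        ⟨_, hF a b u huF, hne, hE.isWeight hu⟩
      have hlt := normSq_single hab h
      exact absurd (hmax hmem hlt.le) (not_le.2 hlt)
    have hC := hE.casimir_of_dominant hu hdom
    set c : ℤ := ∑ a, ∑ b, (if a = b then μ a ^ 2 else max (μ a - μ b) 0)
    have hCk : ∀ k : ℕ, ((∑ a, ∑ b, E a b * E b a) ^ k) u = c ^ k • u := by
      intro k
      induction k with
      | zero => simp
      | succ k ih => rw [pow_succ, Module.End.mul_apply, hC, map_zsmul, ih, smul_smul, pow_succ']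
    have hc : c = 0 := by
      by_contra hc
      have h1 := hCk N
      rw [hN u huF] at h1
      exact hu0 (hdiv ⊥ _ (pow_ne_zero N hc) u (by rw [← h1]; exact zero_mem _))
    have hle : ∑ a, μ a ^ 2 ≤ c := by
      refine Finset.sum_le_sum fun a _ => ?_
      rw [← Finset.add_sum_erase _ _ (Finset.mem_univ a), if_pos rfl]
      refine le_add_of_nonneg_right (Finset.sum_nonneg fun b _ => ?_)
      split_ifs
      · positivity
      · exact le_max_right _ _
    have h0 : ∑ a, μ₀ a ^ 2 ≤ 0 := by
      by_contra hcon
      push Not at hcon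
      have := hmax hμ₀ (by simp only; omega)
      simp only at this
      omega
    funext a
    have := (Finset.sum_eq_zero_iff_of_nonneg (fun a _ => sq_nonneg (μ₀ a))).1
      (le_antisymm h0 (Finset.sum_nonneg fun a _ => sq_nonneg _)) a (Finset.mem_univ a)
    exact pow_eq_zero_iff (two_ne_zero) |>.1 this
  -- every vector has weight zero
  have hwt0 : ∀ u ∈ F, IsWeight E 0 u := by
    intro u hu
    obtain ⟨M, f, hf, hs⟩ := exists_weight_decomposition (hwt u)
    have h1 := weight_mem (fun a => (E a a).toAddMonoidHom) F.toAddSubgroup (hdiv F)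
      (fun a => hF a a) M f hf (by rw [hs]; exact hu)
    intro a
    rw [← hs, map_sum, Finset.smul_sum]
    refine Finset.sum_congr rfl fun μ hμ => ?_
    rcases eq_or_ne (f μ) 0 with h0 | h0
    · rw [h0, map_zero, smul_zero]
    · rw [hf μ hμ a, hzero μ ⟨f μ, h1 μ hμ, h0, hf μ hμ⟩]
  by_cases hab : a = b
  · subst hab
    simpa using hwt0 u hu a
  · by_contra hne
    have := hzero _ ⟨_, hF a b u hu, hne, hE.isWeight (hwt0 u hu)⟩
    simpa [Pi.single_apply, hab] using congrFun this a

/-- Invariants lift modulo a stable subspace. -/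
theorem IsGL.exists_invariant (hE : IsGL E)
    (hwt : ∀ v : V, v ∈ Submodule.span ℚ {u | ∃ μ, IsWeight E μ u})
    (hfin : ∀ v : V, ∃ F : Submodule ℚ V, F.FG ∧ v ∈ F ∧ ∀ a b, ∀ u ∈ F, E a b u ∈ F)
    {W : Submodule ℚ V} (hW : ∀ a b, ∀ u ∈ W, E a b u ∈ W) {v : V} (hv : ∀ a b, E a b v ∈ W) :
    ∃ v', v - v' ∈ W ∧ ∀ a b, E a b v' = 0 := by
  obtain ⟨F, hFG, hvF, hF⟩ := hfin v
  let P : Submodule ℚ V := F ⊓ (W ⊔ ℚ ∙ v)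
  have : FiniteDimensional ℚ F := Module.Finite.iff_fg.2 hFG
  have : FiniteDimensional ℚ P := Submodule.finiteDimensional_of_le inf_le_left
  have hPW : ∀ a b, ∀ u ∈ P, E a b u ∈ W := by
    rintro a b u ⟨-, hu⟩
    obtain ⟨w, hw, z, hz, rfl⟩ := Submodule.mem_sup.1 hu
    obtain ⟨c, rfl⟩ := Submodule.mem_span_singleton.1 hz
    rw [map_add, map_smul]
    exact add_mem (hW a b w hw) (W.smul_mem c (hv a b))
  have hP : ∀ a b, ∀ u ∈ P, E a b u ∈ P := fun a b u hu =>
    ⟨hF a b u hu.1, Submodule.mem_sup_left (hPW a b u hu)⟩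
  set C : Module.End ℚ V := ∑ a, ∑ b, E a b * E b a
  have hCPW : ∀ u ∈ P, C u ∈ W := by
    intro u hu
    simp only [C, LinearMap.sum_apply]
    exact sum_mem fun a _ => sum_mem fun b _ => hPW a b _ (hP b a u hu)
  have hCP : ∀ u ∈ P, C u ∈ P := by
    intro u hu
    simp only [C, LinearMap.sum_apply]
    exact sum_mem fun a _ => sum_mem fun b _ => hP a b _ (hP b a u hu)
  obtain ⟨N, hN, hN1⟩ := ((C.restrict hCP).eventually_isCompl_ker_pow_range_pow.and
    (Filter.eventually_ge_atTop 1)).exists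
  have hpow : ∀ (k : ℕ) (u : P), (((C.restrict hCP) ^ k) u : V) = (C ^ k) u := by
    intro k u
    rw [Module.End.pow_restrict]
    rfl
  have hvP : v ∈ P := ⟨hvF, Submodule.mem_sup_right (Submodule.mem_span_singleton_self v)⟩
  obtain ⟨v₀, hv₀, v₁, ⟨w, rfl⟩, hs⟩ := Submodule.mem_sup.1
    (hN.sup_eq_top ▸ Submodule.mem_top : (⟨v, hvP⟩ : P) ∈ _ ⊔ _)
  refine ⟨v₀, ?_, ?_⟩
  · have h1 : v - v₀ = (C ^ N) w := by
      rw [← hpow, sub_eq_iff_eq_add, add_comm]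
      exact congrArg Subtype.val hs.symm
    rw [h1]
    obtain ⟨N, rfl⟩ := Nat.exists_eq_add_of_le' hN1
    rw [pow_succ', Module.End.mul_apply, ← hpow]
    exact hCPW _ (Subtype.mem _)
  · let F₀ : Submodule ℚ V := P ⊓ LinearMap.ker (C ^ N)
    have : FiniteDimensional ℚ F₀ := Submodule.finiteDimensional_of_le inf_le_left
    have hcomm : ∀ a b, Commute (E a b) (C ^ N) := fun a b =>
      Commute.pow_right (hE.casimir_comm a b) N
    refine fun a b => hE.apply_eq_zero_of_nilpotent hwt (F := F₀) (N := N) (fun a b u hu => ?_)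
      (fun u hu => hu.2) ⟨v₀.2, ?_⟩ a b
    · refine ⟨hP a b u hu.1, ?_⟩
      have := congrArg (fun F => F u) (hcomm a b).eq
      simp only [Module.End.mul_apply] at this
      refine LinearMap.mem_ker.2 ?_
      rw [← this, LinearMap.mem_ker.1 hu.2, map_zero]
    · refine LinearMap.mem_ker.2 ?_
      rw [← hpow, LinearMap.mem_ker.1 hv₀]
      rfl

end Weyl

section Generic

variable {R : Type} [CommRing R] [Algebra ℚ R] {ι κ : Type} [DecidableEq ι] [DecidableEq κ]

lemma exists_derivation_localization (M : Submonoid R) (R' : Type) [CommRing R'] [Algebra ℚ R']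
    [Algebra R R'] [IsScalarTower ℚ R R'] [IsLocalization M R'] (D : Derivation ℚ R R) :
    ∃ D' : Derivation ℚ R' R', ∀ r, D' (algebraMap R R' r) = algebraMap R R' (D r) := by
  have := Algebra.FormallyEtale.of_isLocalization (Rₘ := R') M
  let e := KaehlerDifferential.tensorKaehlerEquivOfFormallyEtale ℚ R R'
  let f : TensorProduct R R' (Ω[R⁄ℚ]) →ₗ[R'] R' :=
    LinearMap.liftBaseChange R' (Algebra.linearMap R R' ∘ₗ D.liftKaehlerDifferential)
  refine ⟨(f ∘ₗ e.symm.toLinearMap).compDer (KaehlerDifferential.D ℚ R'), fun r => ?_⟩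
  have h := KaehlerDifferential.tensorKaehlerEquivOfFormallyEtale_symm_D_algebraMap ℚ R R' r
  exact (congrArg f h).trans (by simp [f])

/-- A matrix whose entries are coordinates over the common constants of commuting-type
derivations dual to them. -/
def Generic (X : Matrix ι κ R) : Prop :=
  ∃ D : ι → κ → Derivation ℚ R R,
    (∀ a j b k, D a j (X b k) = if a = b ∧ j = k then 1 else 0) ∧
    Subring.closure ({r | ∀ a j, D a j r = 0} ∪ {r | ∃ a j, r = X a j}) = ⊤

lemma generic_of_mvPolynomial {K : Type} [Field K] [CharZero K] [Algebra ℚ K] :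
    Generic (Matrix.of fun (a : ι) (j : κ) => (MvPolynomial.X (a, j) : MvPolynomial (ι × κ) K)) := by
  refine ⟨fun a j => (MvPolynomial.pderiv (a, j)).restrictScalars ℚ, fun a j b k => ?_, ?_⟩
  · change MvPolynomial.pderiv (a, j) (MvPolynomial.X (b, k)) = _
    rw [MvPolynomial.pderiv_X, Pi.single_apply]
    simp [Prod.ext_iff, eq_comm]
  · rw [eq_top_iff]
    rintro p -
    induction p using MvPolynomial.induction_on with
    | C r =>
      refine Subring.subset_closure (Or.inl fun a j => ?_)
      exact MvPolynomial.pderiv_C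
    | add p q hp hq => exact add_mem hp hq
    | mul_X p i hp => exact mul_mem hp (Subring.subset_closure (Or.inr ⟨i.1, i.2, rfl⟩))

lemma Generic.schur {X : Matrix ι κ R} (hX : Generic X) (a₀ : ι) (b₀ : κ) (R' : Type)
    [CommRing R'] [Algebra ℚ R'] [Algebra R R'] [IsScalarTower ℚ R R']
    [IsLocalization.Away (X a₀ b₀) R'] {y : R'} (hy : algebraMap R R' (X a₀ b₀) * y = 1) :
    Generic (DR.schur (X.map (algebraMap R R')) y a₀ b₀) := by
  obtain ⟨D, hD, hcl⟩ := hX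
  choose D' hD' using fun a j =>
    exists_derivation_localization (Submonoid.powers (X a₀ b₀)) R' (D a j)
  have hy' : ∀ a b, (a, b) ≠ (a₀, b₀) → D' a b y = 0 := by
    intro a b hab
    have h := congrArg (D' a b) hy
    rw [Derivation.leibniz, hD', hD, if_neg (by simpa [Prod.ext_iff] using hab), map_zero, smul_zero,
      add_zero, Derivation.map_one_eq_zero] at h
    rw [smul_eq_mul] at h
    have h2 : algebraMap R R' (X a₀ b₀) * y * D' a b y = 0 := by linear_combination y * h
    rwa [hy, one_mul] at h2
  have hX' : ∀ a b c d, D' a b (algebraMap R R' (X c d)) = if a = c ∧ b = d then 1 else 0 := by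
    intro a b c d
    rw [hD', hD]
    split_ifs <;> simp
  refine ⟨fun a j => D' a j, fun a j b k => ?_, ?_⟩
  · have ha := a.2
    have hj := j.2
    have := hy' a j (by simp [ha])
    simp [DR.schur, hX', this, ha, hj, Subtype.coe_inj]
  · rw [eq_top_iff]
    rintro r -
    set Q := Subring.closure ({r | ∀ (a : {a // a ≠ a₀}) (j : {b // b ≠ b₀}), D' a j r = 0} ∪
      {r | ∃ a j, r = DR.schur (X.map (algebraMap R R')) y a₀ b₀ a j}) with hQ
    have hconst : ∀ r, (∀ a j, a ≠ a₀ → j ≠ b₀ → D' a j r = 0) → r ∈ Q := fun r h =>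
      Subring.subset_closure (Or.inl fun a j => h a j a.2 j.2)
    have hyQ : y ∈ Q := hconst _ fun a j ha hj => hy' a j (by simp [ha])
    have hrow : ∀ b, algebraMap R R' (X a₀ b) ∈ Q := fun b =>
      hconst _ fun a j ha hj => by rw [hX', if_neg (by simp [ha])]
    have hcol : ∀ a, algebraMap R R' (X a b₀) ∈ Q := fun b =>
      hconst _ fun a j ha hj => by rw [hX', if_neg (by simp [hj])]
    have hall : ∀ a b, algebraMap R R' (X a b) ∈ Q := by
      intro a b
      by_cases ha : a = a₀
      · exact ha ▸ hrow b
      by_cases hb : b = b₀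
      · exact hb ▸ hcol a
      have h1 : DR.schur (X.map (algebraMap R R')) y a₀ b₀ ⟨a, ha⟩ ⟨b, hb⟩ ∈ Q :=
        Subring.subset_closure (Or.inr ⟨_, _, rfl⟩)
      have h2 := add_mem h1 (mul_mem (mul_mem (hcol a) hyQ) (hrow b))
      simpa [DR.schur] using h2
    have hR : ∀ s, algebraMap R R' s ∈ Q := by
      intro s
      have hs : s ∈ Q.comap (algebraMap R R') := by
        refine (hcl ▸ (?_ : Subring.closure _ ≤ _)) (Subring.mem_top s)
        rw [Subring.closure_le]
        rintro t (ht | ⟨a, j, rfl⟩)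
        · exact hconst _ fun a j _ _ => by rw [hD', ht, map_zero]
        · exact hall a j
      exact hs
    obtain ⟨⟨s, ⟨_, N, rfl⟩⟩, hs⟩ := IsLocalization.surj (Submonoid.powers (X a₀ b₀)) r
    have : r = algebraMap R R' s * y ^ N := by
      rw [← hs]
      simp only [map_pow]
      rw [mul_assoc, ← mul_pow, hy, one_pow, mul_one]
    rw [this]
    exact mul_mem (hR s) (pow_mem hyQ N)

end Generic

section

variable {R : Type} [CommRing R] [Algebra ℚ R] {ι κ : Type} [Fintype ι] [DecidableEq κ]
  {X : Matrix ι κ R}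

namespace DR

/-- Lifts of derivations of `R` to the de Rham algebra, in the manner of Lie derivatives. -/
structure IsLift (D : Derivation ℚ R R) (F : AddMonoid.End (DR X)) : Prop where
  skew : IsSkew id F
  apply_algebraMap : ∀ r, F (algebraMap R _ r) = algebraMap R _ (D r)
  d_apply : ∀ w, d X (F w) = F (d X w)
  deg_apply : ∀ w, deg X (F w) = F (deg X w)

lemma IsLift.mul {D : Derivation ℚ R R} {F : AddMonoid.End (DR X)} (h : IsLift D F) (a b) :
    F (a * b) = F a * b + a * F b := h.skew a b

lemma IsLift.smul {D : Derivation ℚ R R} {F : AddMonoid.End (DR X)} (h : IsLift D F) (r : R)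
    (w : DR X) : F (r • w) = D r • w + r • F w := by
  simp only [Algebra.smul_def, h.mul, h.apply_algebraMap]

lemma IsLift.apply_θ {D : Derivation ℚ R R} {F : AddMonoid.End (DR X)} (h : IsLift D F) (j a) :
    F (θ X j a) = d X (F (l X j a)) := by
  rw [h.d_apply, d_l]

lemma IsLift.mem_Om {D : Derivation ℚ R R} {F : AddMonoid.End (DR X)} (h : IsLift D F) {i : ℕ}
    {w : DR X} (hw : w ∈ Om X i) : F w ∈ Om X i := by
  rw [DR.mem_Om] at *
  rw [h.deg_apply, hw, map_nsmul]

lemma IsLift.mem_Bd {D : Derivation ℚ R R} {F : AddMonoid.End (DR X)} (h : IsLift D F) {i : ℕ}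
    {w : DR X} (hw : w ∈ Bd X i) : F w ∈ Bd X i := by
  cases i with
  | zero =>
    obtain ⟨r, rfl⟩ := mem_Bd_zero.1 hw
    exact mem_Bd_zero.2 ⟨D r, (h.apply_algebraMap r).symm⟩
  | succ i =>
    obtain ⟨η, hη, rfl⟩ := mem_Bd_succ.1 hw
    exact mem_Bd_succ.2 ⟨F η, h.mem_Om hη, h.d_apply η⟩

lemma exists_isLift (D : Derivation ℚ R R) {l' : Matrix κ ι (DR X)}
    (hc : ∀ j a, l' j a ∈ Subring.center (DR X)) (hdeg : ∀ j a, deg X (l' j a) = 0)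
    (hpar : ∀ j a, parity X (l' j a) = l' j a)
    (hX : l X * (X.map D).map (algebraMap R (DR X)) + l' * X.map (algebraMap R (DR X)) = 0) :
    ∃ F : AddMonoid.End (DR X), IsLift D F ∧ ∀ j a, F (l X j a) = l' j a := by
  have hanti : ∀ j a, (l'.map (d X)) j a ∈ anti X := by
    intro j a k b
    have h1 := d_mul_of_center (hc j a) (hpar j a) (θ X k b)
    rw [Matrix.map_apply, h1, parity_θ, neg_mul, neg_add_cancel]
  have hθ : θ X * (X.map D).map (algebraMap R (DR X)) +
      l'.map (d X) * X.map (algebraMap R (DR X)) = 0 := by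
    refine Matrix.ext fun j k => ?_
    have h1 := congrArg (d X) (congrFun (congrFun hX j) k)
    simpa [Matrix.add_apply, Matrix.mul_apply, d_mul] using h1
  have hdata := data_even D hc hanti hX hθ
  let F : AddMonoid.End (DR X) := hdata.skew
  have hF : IsSkew id F := hdata.skew_mul
  have hFr : ∀ r, F (algebraMap R _ r) = algebraMap R _ (D r) := hdata.skew_algebraMap
  have hFl : ∀ j a, F (l X j a) = l' j a := hdata.skew_l
  have hFθ : ∀ j a, F (θ X j a) = d X (l' j a) := hdata.skew_θ
  have hFm : ∀ a b, F (a * b) = F a * b + a * F b := hF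
  have hFpar : ∀ w, F (parity X w) = parity X (F w) := by
    intro w
    induction w using DR.induction with
    | hr r => simp [hFr]
    | hl j a => simp [hFl, hpar]
    | hθ j a =>
      have := d_parity (l' j a)
      rw [hpar] at this
      rw [parity_θ, map_neg, hFθ]
      exact neg_eq_iff_eq_neg.2 this
    | hadd a b ha hb => simp [ha, hb]
    | hmul a b ha hb => simp [ha, hb, hFm]
  refine ⟨F, ⟨hF, hFr, fun w => ?_, fun w => ?_⟩, hFl⟩
  · induction w using DR.induction with
    | hr r => simp [hFr]
    | hl j a => simp [hFl, hFθ]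
    | hθ j a => simp [hFθ, d_d]
    | hadd a b ha hb => simp [ha, hb]
    | hmul a b ha hb =>
      simp only [hFm, d_mul, map_add, ha, hb, hFpar]
      abel
  · induction w using DR.induction with
    | hr r => simp [hFr]
    | hl j a => simp [hFl, hdeg]
    | hθ j a => simp [hFθ, deg_d, hdeg]
    | hadd a b ha hb => simp [ha, hb]
    | hmul a b ha hb =>
      simp only [hFm, deg_mul, map_add, ha, hb]
      abel

section Coordinates

variable [DecidableEq ι] [Fintype κ] {D : ι → κ → Derivation ℚ R R}
  (hD : ∀ a j b k, D a j (X b k) = if a = b ∧ j = k then 1 else 0)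

include hD

lemma exists_coordinate_lift (b : ι) (k : κ) : ∃ F : AddMonoid.End (DR X), IsLift (D b k) F ∧
    ∀ j c, F (l X j c) = -(l X j b * l X k c) := by
  refine exists_isLift (D b k) (l' := Matrix.of fun j c => -(l X j b * l X k c)) (fun j c => ?_)
    (fun j c => ?_) (fun j c => ?_) ?_
  · exact neg_mem (mul_mem (l_mem_center _ _) (l_mem_center _ _))
  · simp [deg_mul]
  · simp
  · refine Matrix.ext fun j p => ?_
    have h : ∑ c, l X k c * algebraMap R (DR X) (X c p) = (1 : Matrix κ κ (DR X)) k p := by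
      rw [← (realizes X).l_X]; rfl
    simp [Matrix.mul_apply, hD, mul_assoc, ← Finset.mul_sum, h, Matrix.one_apply,
      ite_and, apply_ite (algebraMap R (DR X))]

/-- The derivations of `R` giving the action of the general linear Lie algebra. -/
noncomputable def gl (X : Matrix ι κ R) (D : ι → κ → Derivation ℚ R R) (a b : ι) :
    Derivation ℚ R R := ∑ k, X a k • D b k

lemma gl_apply_X (a b c : ι) (k : κ) : gl X D a b (X c k) = if b = c then X a k else 0 := by
  have (x : R) : gl X D a b x = ∑ k, X a k * D b k x := by
    change Derivation.coeFnAddMonoidHom (∑ k, X a k • D b k) x = _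
    simp [Finset.sum_apply]
  simp [this, hD, ite_and]

lemma exists_gl_lift (a b : ι) : ∃ F : AddMonoid.End (DR X), IsLift (gl X D a b) F ∧
    ∀ j c, F (l X j c) = if a = c then -l X j b else 0 := by
  refine exists_isLift (gl X D a b) (l' := Matrix.of fun j c => if a = c then -l X j b else 0)
    (fun j c => ?_) (fun j c => ?_) (fun j c => ?_) ?_
  · rw [Matrix.of_apply]
    split_ifs
    exacts [neg_mem (l_mem_center _ _), zero_mem _]
  · rw [Matrix.of_apply]
    split_ifs <;> simp
  · rw [Matrix.of_apply]
    split_ifs <;> simp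
  · refine Matrix.ext fun j p => ?_
    simp [Matrix.mul_apply, gl_apply_X hD, apply_ite (algebraMap R (DR X))]

end Coordinates

end DR

end

section

variable {R : Type} [CommRing R] [Algebra ℚ R] {ι κ : Type} [Fintype ι] [DecidableEq κ]
  {X : Matrix ι κ R}

namespace DR

variable [DecidableEq ι] [Fintype κ] {D : ι → κ → Derivation ℚ R R}
  (hD : ∀ a j b k, D a j (X b k) = if a = b ∧ j = k then 1 else 0)
  {E : ι → ι → AddMonoid.End (DR X)} (hE : ∀ a b, IsLift (gl X D a b) (E a b))
  (hEl : ∀ a b j c, E a b (l X j c) = if a = c then -l X j b else 0)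

lemma gl_apply (a b : ι) (x : R) : gl X D a b x = ∑ k, X a k * D b k x := by
  change Derivation.coeFnAddMonoidHom (∑ k, X a k • D b k) x = _
  simp [Finset.sum_apply]

include hE hEl in
lemma gl_lift_θ (a b : ι) (j c) : E a b (θ X j c) = if a = c then -θ X j b else 0 := by
  rw [(hE a b).apply_θ, hEl]
  split_ifs <;> simp

include hE hEl in
/-- On closed forms the coordinate operators and the linear ones agree modulo boundaries. -/
lemma coordinate_sub_gl_mem_Bd {F : ι → κ → AddMonoid.End (DR X)}
    (hF : ∀ b k, IsLift (D b k) (F b k)) (hFl : ∀ b k j c, F b k (l X j c) = -(l X j b * l X k c))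
    (a b : ι) {i : ℕ} {w : DR X} (hw : w ∈ Om X i) (hdw : d X w = 0) :
    ∑ k, X a k • F b k w - E a b w ∈ Bd X i := by
  let W : Matrix κ ι (DR X) := Matrix.of fun j c =>
    (if a = c then l X j b else 0) - ∑ k, X a k • (l X j b * l X k c)
  have hW : IsVertical W := by
    refine ⟨fun j c => ?_, fun j c => ?_, fun j c => ?_, Matrix.ext fun j p => ?_⟩
    · refine sub_mem (?_ : (if a = c then l X j b else 0) ∈ _) (sum_mem fun k _ => ?_)
      · split_ifs
        exacts [l_mem_center _ _, zero_mem _]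
      · rw [Algebra.smul_def]
        exact mul_mem (algebraMap_mem_center _) (mul_mem (l_mem_center _ _) (l_mem_center _ _))
    · simp only [W, Matrix.of_apply]
      split_ifs <;> simp [deg_smul, deg_mul]
    · simp only [W, Matrix.of_apply]
      split_ifs <;> simp [Algebra.smul_def]
    · have h : ∀ k, ∑ c, l X k c * algebraMap R (DR X) (X c p) = (1 : Matrix κ κ (DR X)) k p := by
        intro k
        rw [← (realizes X).l_X]; rfl
      have h2 : ∀ q, ∑ c, (∑ k, X a k • (l X j b * l X k c)) * algebraMap R (DR X) (X c q) =
          algebraMap R (DR X) (X a q) * l X j b := by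
        intro q
        have h : ∀ k, ∑ c, l X k c * algebraMap R (DR X) (X c q) =
            (1 : Matrix κ κ (DR X)) k q := by
          intro k
          rw [← (realizes X).l_X]; rfl
        simp only [Finset.sum_mul, smul_mul_assoc, mul_assoc]
        rw [Finset.sum_comm]
        simp only [← Finset.smul_sum, ← Finset.mul_sum, h]
        simp [Matrix.one_apply, Algebra.smul_def]
      simp only [W, Matrix.mul_apply, Matrix.of_apply, Matrix.map_apply, sub_mul,
        Finset.sum_sub_distrib, h2]
      simp [Algebra.commutes]
  have key : ∑ k, X a k • F b k w - E a b w = vert hW w := by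
    let G : AddMonoid.End (DR X) :=
      AddMonoidHom.mk' (fun w => ∑ k, X a k • F b k w - E a b w) fun x y => by
        simp only [map_add, smul_add, Finset.sum_add_distrib]
        abel
    have hG : ∀ w, G w = ∑ k, X a k • F b k w - E a b w := fun w => rfl
    have hGW : ∀ j c, G (l X j c) = W j c := by
      intro j c
      rw [hG, hEl]
      simp only [hFl, W, Matrix.of_apply, smul_neg, Finset.sum_neg_distrib]
      split_ifs <;> abel
    have hGd : ∀ w, G (d X w) = d X (G w) := by
      intro w
      simp [hG, map_sub, map_sum, d_smul, (hF _ _).d_apply, (hE _ _).d_apply]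
    suffices G = vert hW from DFunLike.congr_fun this w
    refine isSkew_ext (σ := id) (fun x y => ?_) (vert_skew hW) (fun r => ?_) (fun j c => ?_)
      (fun j c => ?_)
    · simp only [hG, (hF _ _).mul, (hE _ _).mul, smul_add, Finset.sum_add_distrib, id_eq, sub_mul,
        mul_sub, Finset.sum_mul, Finset.mul_sum, smul_mul_assoc, mul_smul_comm]
      abel
    · rw [vert_algebraMap, hG, (hE _ _).apply_algebraMap, gl_apply, map_sum, sub_eq_zero]
      simp [(hF _ _).apply_algebraMap, Algebra.smul_def]
    · rw [hGW, vert_l]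
    · rw [vert_θ, ← d_l, hGd, hGW]
  rw [key, vert_apply, hdw, map_zero, add_zero]
  have hc := deg_contr hW w
  rw [hw, map_nsmul] at hc
  cases i with
  | zero =>
    rw [zero_smul, zero_sub] at hc
    rw [eq_zero_of_deg_neg hc, map_zero]
    exact zero_mem _
  | succ i =>
    refine mem_Bd_succ.2 ⟨_, ?_, rfl⟩
    rw [mem_Om, hc, succ_nsmul, add_sub_cancel_right]

include hD hE hEl in
lemma gl_lift_comm (hcl : Subring.closure ({r | ∀ a j, D a j r = 0} ∪ {r | ∃ a j, r = X a j}) = ⊤)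
    (a b c e : ι) : E a b * E c e - E c e * E a b =
      (if b = c then E a e else 0) - (if a = e then E c b else 0) := by
  have hr : ∀ r, gl X D a b (gl X D c e r) - gl X D c e (gl X D a b r) =
      (if b = c then gl X D a e r else 0) - (if a = e then gl X D c b r else 0) := by
    intro r
    have hr : r ∈ Subring.closure ({r | ∀ a j, D a j r = 0} ∪ {r | ∃ a j, r = X a j}) := by
      rw [hcl]; trivial
    induction hr using Subring.closure_induction with
    | mem r h =>
      rcases h with h | ⟨f, k, rfl⟩
      · have h0 : ∀ a b, gl X D a b r = 0 := fun a b => by simp [gl_apply, h _ _]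
        simp [h0]
      · have hite : ∀ (a b : ι) (p : Prop) [Decidable p] (x : R),
            gl X D a b (if p then x else 0) = if p then gl X D a b x else 0 := by
          intro a b p _ x
          split_ifs <;> simp
        simp only [gl_apply_X hD, hite, eq_comm (a := e)]
        by_cases b = c <;> by_cases a = e <;> simp [*]
    | zero => simp
    | one => simp
    | add x y _ _ hx hy =>
      simp only [map_add]
      rw [add_sub_add_comm, hx, hy]
      split_ifs <;> abel
    | neg x _ hx =>
      simp only [map_neg]
      rw [neg_sub_neg, ← neg_sub, hx]
      split_ifs <;> abel
    | mul x y _ _ hx hy =>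
      have h1 := congrArg (x * ·) hy
      have h2 := congrArg (y * ·) hx
      simp only [Derivation.leibniz, map_add, smul_eq_mul] at h1 h2 ⊢
      split_ifs at h1 h2 ⊢ <;>
        linear_combination h1 + h2
  have hθ := gl_lift_θ hE hEl
  have hm := fun a b => (hE a b).mul
  have hite : ∀ (a b : ι) (p : Prop) [Decidable p] (x : DR X),
      E a b (if p then x else 0) = if p then E a b x else 0 := by
    intro a b p _ x
    split_ifs <;> simp
  refine isSkew_ext (σ := id) (fun x y => ?_) (fun x y => ?_) (fun r => ?_) (fun j f => ?_)
    (fun j f => ?_)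
  · simp only [end_sub_apply, end_mul_apply, hm, map_add, id]
    noncomm_ring
  · split_ifs <;> simp only [end_sub_apply, end_zero_apply, hm, id] <;> noncomm_ring
  · simp only [end_sub_apply, end_mul_apply, (hE _ _).apply_algebraMap]
    rw [← map_sub, hr]
    split_ifs <;> simp [(hE _ _).apply_algebraMap]
  · simp only [end_sub_apply, end_mul_apply, hEl, hite, map_neg]
    by_cases b = c <;> by_cases a = e <;> simp [*, eq_comm (a := c)] <;> grind
  · simp only [end_sub_apply, end_mul_apply, hθ, hite, map_neg]
    by_cases b = c <;> by_cases a = e <;> simp [*, eq_comm (a := c)] <;> grind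

end DR

end

section Subring

variable {ι A : Type} [Ring A] [Algebra ℚ A] {E : ι → ι → Module.End ℚ A}
  (hmul : ∀ a b x y, E a b (x * y) = E a b x * y + x * E a b y)

/-- A stable finite-dimensional space spanned by weight vectors. -/
def IsFinitary (E : ι → ι → Module.End ℚ A) (F : Submodule ℚ A) : Prop :=
  F.FG ∧ (∀ a b, ∀ u ∈ F, E a b u ∈ F) ∧ F ≤ Submodule.span ℚ {u | ∃ μ, IsWeight E μ u}

lemma isFinitary_span_range {T : Type} [Finite T] (v : T → A)
    (hv : ∀ a b t, E a b (v t) ∈ Submodule.span ℚ (Set.range v))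
    (hwt : ∀ t, ∃ μ, IsWeight E μ (v t)) : IsFinitary E (Submodule.span ℚ (Set.range v)) := by
  refine ⟨Submodule.fg_span (Set.finite_range v), fun a b u hu => ?_, ?_⟩
  · have h : Submodule.span ℚ (Set.range v) ≤ (Submodule.span ℚ (Set.range v)).comap (E a b) := by
      rw [Submodule.span_le]
      rintro _ ⟨t, rfl⟩
      exact hv a b t
    exact h hu
  · refine Submodule.span_mono ?_
    rintro _ ⟨t, rfl⟩
    exact hwt t

include hmul in
lemma IsFinitary.mul {F G : Submodule ℚ A} (hF : IsFinitary E F) (hG : IsFinitary E G) :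
    IsFinitary E (F * G) := by
  refine ⟨hF.1.mul hG.1, fun a b u hu => ?_, ?_⟩
  · refine Submodule.mul_induction_on hu (fun x hx y hy => ?_) fun x y hx hy => ?_
    · rw [hmul]
      exact add_mem (Submodule.mul_mem_mul (hF.2.1 a b x hx) hy)
        (Submodule.mul_mem_mul hx (hG.2.1 a b y hy))
    · rw [map_add]
      exact add_mem hx hy
  · refine (mul_le_mul' hF.2.2 hG.2.2).trans ?_
    rw [Submodule.span_mul_span]
    refine Submodule.span_mono ?_
    rintro _ ⟨x, ⟨μ, hμ⟩, y, ⟨ν, hν⟩, rfl⟩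
    refine ⟨μ + ν, fun a => ?_⟩
    change E a a (x * y) = (μ a + ν a) • (x * y)
    rw [hmul, hμ a, hν a, add_smul, smul_mul_assoc, mul_smul_comm]

lemma IsFinitary.sup {F G : Submodule ℚ A} (hF : IsFinitary E F) (hG : IsFinitary E G) :
    IsFinitary E (F ⊔ G) := by
  refine ⟨hF.1.sup hG.1, fun a b u hu => ?_, sup_le hF.2.2 hG.2.2⟩
  obtain ⟨x, hx, y, hy, rfl⟩ := Submodule.mem_sup.1 hu
  rw [map_add]
  exact Submodule.add_mem_sup (hF.2.1 a b x hx) (hG.2.1 a b y hy)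

/-- The subring of elements lying in finitary subspaces. -/
def finitary : Subring A where
  carrier := {w | ∃ F, IsFinitary E F ∧ w ∈ F}
  mul_mem' := by
    rintro x y ⟨F, hF, hx⟩ ⟨G, hG, hy⟩
    exact ⟨_, hF.mul hmul hG, Submodule.mul_mem_mul hx hy⟩
  add_mem' := by
    rintro x y ⟨F, hF, hx⟩ ⟨G, hG, hy⟩
    exact ⟨_, hF.sup hG, Submodule.add_mem_sup hx hy⟩
  one_mem' := by
    have h1 : ∀ a b, E a b (1 : A) = 0 := fun a b => by simpa using hmul a b 1 1
    exact ⟨_, isFinitary_span_range (fun _ : Unit => (1 : A)) (fun a b _ => by simp [h1])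
      (fun _ => ⟨0, fun a => by simp [h1]⟩), Submodule.subset_span ⟨(), rfl⟩⟩
  zero_mem' := by
    exact ⟨⊥, ⟨Submodule.fg_bot, by simp, bot_le⟩, zero_mem _⟩
  neg_mem' := by
    rintro x ⟨F, hF, hx⟩
    exact ⟨F, hF, neg_mem hx⟩

end Subring

section

variable {R : Type} [CommRing R] [Algebra ℚ R] {ι κ : Type} [Fintype ι] [DecidableEq κ]
  {X : Matrix ι κ R}

namespace DR

variable [DecidableEq ι] [Fintype κ] {D : ι → κ → Derivation ℚ R R}
  (hD : ∀ a j b k, D a j (X b k) = if a = b ∧ j = k then 1 else 0)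
  {E : ι → ι → AddMonoid.End (DR X)} (hE : ∀ a b, IsLift (gl X D a b) (E a b))
  (hEl : ∀ a b j c, E a b (l X j c) = if a = c then -l X j b else 0)

include hD hE hEl

lemma sum_smul_gl_lift
    (hcl : Subring.closure ({r | ∀ a j, D a j r = 0} ∪ {r | ∃ a j, r = X a j}) = ⊤) (w : DR X) :
    ∑ a, ∑ b, ((if a = b then 1 else 0) - ∑ k, algebraMap R (DR X) (X b k) * l X k a) * E a b w =
      -deg X w := by
  set P : ι → ι → DR X := fun b a =>
    (if a = b then 1 else 0) - ∑ k, algebraMap R (DR X) (X b k) * l X k a with hP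
  have hPc : ∀ a b, P b a ∈ Subring.center (DR X) := fun a b =>
    sub_mem (by split_ifs; exacts [one_mem _, zero_mem _])
      (sum_mem fun k _ => mul_mem (algebraMap_mem_center _) (l_mem_center _ _))
  let G : AddMonoid.End (DR X) := AddMonoidHom.mk' (fun w => ∑ a, ∑ b, P b a * E a b w)
    fun x y => by simp only [map_add, mul_add, Finset.sum_add_distrib]
  have hG : ∀ w, G w = ∑ a, ∑ b, P b a * E a b w := fun w => rfl
  have hGmul : ∀ x y, G (x * y) = G x * y + x * G y := by
    intro x y
    simp only [hG, (hE _ _).mul, mul_add, Finset.sum_add_distrib, Finset.sum_mul, Finset.mul_sum,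
      mul_assoc]
    congr 1
    refine Finset.sum_congr rfl fun a _ => Finset.sum_congr rfl fun b _ => ?_
    rw [← mul_assoc, ← Subring.mem_center_iff.1 (hPc a b), mul_assoc]
  have hθ := gl_lift_θ hE hEl
  have hlX : ∀ k p, ∑ c, l X k c * algebraMap R (DR X) (X c p) = (1 : Matrix κ κ (DR X)) k p := by
    intro k p
    rw [← (realizes X).l_X]; rfl
  have hPX : ∀ b k, ∑ a, P b a * algebraMap R (DR X) (X a k) = 0 := by
    intro b k
    simp only [hP, sub_mul, Finset.sum_sub_distrib, Finset.sum_mul]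
    rw [Finset.sum_comm]
    simp only [mul_assoc, ← Finset.mul_sum, hlX]
    simp [Matrix.one_apply]
  have hGr : ∀ r, G (algebraMap R _ r) = 0 := by
    intro r
    have hr : r ∈ Subring.closure ({r | ∀ a j, D a j r = 0} ∪ {r | ∃ a j, r = X a j}) := by
      rw [hcl]; trivial
    induction hr using Subring.closure_induction with
    | mem r h =>
      rcases h with h | ⟨f, k, rfl⟩
      · simp [hG, (hE _ _).apply_algebraMap, gl_apply, h _ _]
      · simp only [hG, (hE _ _).apply_algebraMap, gl_apply_X hD]
        rw [Finset.sum_comm]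
        simp [apply_ite (algebraMap R (DR X)), hPX]
    | zero => simp
    | one => simpa using hGmul 1 1
    | add x y _ _ hx hy => simp [hx, hy]
    | neg x _ hx => simp [hx]
    | mul x y _ _ hx hy => simp [hGmul, hx, hy]
  have hPl : ∀ j c, ∑ b, P b c * l X j b = 0 := by
    intro j c
    simp only [hP, sub_mul, Finset.sum_sub_distrib, Finset.sum_mul]
    rw [Finset.sum_comm]
    have h : ∀ b k, algebraMap R (DR X) (X b k) * l X k c * l X j b =
        l X j b * algebraMap R (DR X) (X b k) * l X k c := fun b k => by
      rw [← Subring.mem_center_iff.1 (l_mem_center j b), mul_assoc,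
        Subring.mem_center_iff.1 (l_mem_center j b) (l X k c), ← mul_assoc]
    simp only [h, ← Finset.sum_mul, hlX]
    simp [Matrix.one_apply]
  have hPθ : ∀ j c, ∑ b, P b c * θ X j b = θ X j c := by
    intro j c
    have h0 : ∀ k, ∑ b, θ X j b * algebraMap R (DR X) (X b k) = 0 := fun k =>
      congrFun (congrFun (realizes X).θ_X j) k
    simp only [hP, sub_mul, Finset.sum_sub_distrib, Finset.sum_mul]
    rw [Finset.sum_comm]
    have h : ∀ b k, algebraMap R (DR X) (X b k) * l X k c * θ X j b =
        θ X j b * algebraMap R (DR X) (X b k) * l X k c := fun b k => by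
      rw [← Subring.mem_center_iff.1 (mul_mem (algebraMap_mem_center _) (l_mem_center k c)),
        mul_assoc]
    simp only [h, ← Finset.sum_mul, h0]
    simp
  change G w = (-deg X) w
  refine end_ext (σ := id) (τ := id) hGmul (fun x y => ?_) (fun r => ?_) (fun j c => ?_)
    (fun j c => ?_) w
  · simp only [end_neg_apply, deg_mul, id_eq]
    noncomm_ring
  · simp [hGr]
  · rw [hG, Finset.sum_comm]
    simp [hEl, hPl]
  · rw [hG, Finset.sum_comm]
    simp [hθ, hPθ]

end DR

end

namespace DR

lemma mem_Bd_of_smul_mem_Bd {R : Type} [CommRing R] [Algebra ℚ R] {ι κ : Type} [Fintype ι]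
    [DecidableEq κ] {X : Matrix ι κ R} [DecidableEq ι] [Fintype κ] (hX : Generic X) {c i : ℕ}
    (hc : Fintype.card ι = Fintype.card κ + c) (hi : i ≠ Fintype.card κ * c) {v : DR X}
    (hv : v ∈ Om X i) (hdv : d X v = 0) (h : ∀ a k, X a k • v ∈ Bd X i) : v ∈ Bd X i := by
  obtain ⟨D, hD, hcl⟩ := hX
  choose F hF hFl using fun b k => exists_coordinate_lift (X := X) hD b k
  choose E hE hEl using fun a b => exists_gl_lift (X := X) hD a b
  have hθ := gl_lift_θ hE hEl
  let _ : Algebra ℚ (DR X) := Algebra.compHom (DR X) (algebraMap ℚ R)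
  have : IsScalarTower ℚ R (DR X) := IsScalarTower.of_algebraMap_eq' rfl
  set n := Fintype.card κ with hn
  let E₀ : ι → ι → Module.End ℚ (DR X) := fun a b => (E a b).toRatLinearMap
  have hE₀ : ∀ a b w, E₀ a b w = E a b w := fun _ _ _ => rfl
  let E' : ι → ι → Module.End ℚ (DR X) := fun a b => E₀ a b + if a = b then (n : ℤ) • 1 else 0
  have hE' : ∀ a b w, E' a b w = E a b w + if a = b then (n : ℤ) • w else 0 := by
    intro a b w
    simp only [E', LinearMap.add_apply, hE₀]
    split_ifs <;> rfl
  have hGL : IsGL E' := by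
    intro a b p q
    have h1 := gl_lift_comm hD hE hEl hcl a b p q
    have h2 : E₀ a b * E₀ p q - E₀ p q * E₀ a b =
        (if b = p then E₀ a q else 0) - (if a = q then E₀ p b else 0) := by
      refine LinearMap.ext fun w => ?_
      have h3 := DFunLike.congr_fun h1 w
      split_ifs at h3 ⊢ <;> exact h3
    have hz : ∀ (a b : ι) (f : Module.End ℚ (DR X)), (if a = b then (n : ℤ) • 1 else 0) * f =
        f * (if a = b then (n : ℤ) • 1 else 0) := by
      intro a b f
      split_ifs
      · simpa using (Nat.cast_commute n f).eq
      · rw [zero_mul, mul_zero]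
    have h4 : E' a b * E' p q - E' p q * E' a b = E₀ a b * E₀ p q - E₀ p q * E₀ a b := by
      simp only [E', mul_add, add_mul]
      rw [hz a b (E₀ p q), hz p q (E₀ a b), hz a b (if p = q then _ else _)]
      abel
    rw [h4, h2]
    simp only [E']
    rcases eq_or_ne b p with rfl | h5 <;> rcases eq_or_ne a q with rfl | h6
    · simp
    · simp [h6]
    · simp [h5, h5.symm]
    · simp [h5, h6]
  have hmul : ∀ a b x y, E₀ a b (x * y) = E₀ a b x * y + x * E₀ a b y := fun a b => (hE a b).mul
  have hfinR : ∀ r, algebraMap R (DR X) r ∈ finitary hmul := by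
    intro r
    have hr : r ∈ (finitary hmul).comap (algebraMap R (DR X)) := by
      refine (hcl ▸ (?_ : Subring.closure _ ≤ _)) (Subring.mem_top r)
      rw [Subring.closure_le]
      rintro r (h | ⟨f, k, rfl⟩)
      · have h0 : ∀ a b, E₀ a b (algebraMap R (DR X) r) = 0 := fun a b => by
          rw [hE₀, (hE a b).apply_algebraMap]
          simp [gl_apply, h _ _]
        exact ⟨_, isFinitary_span_range (fun _ : Unit => algebraMap R (DR X) r)
          (fun a b _ => by rw [h0]; exact zero_mem _) (fun _ => ⟨0, fun a => by simp [h0]⟩),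
          Submodule.subset_span ⟨(), rfl⟩⟩
      · have h0 : ∀ a b f, E₀ a b (algebraMap R (DR X) (X f k)) =
            if b = f then algebraMap R (DR X) (X a k) else 0 := fun a b f => by
          rw [hE₀, (hE a b).apply_algebraMap, gl_apply_X hD]
          split_ifs <;> simp
        refine ⟨_, isFinitary_span_range (fun f => algebraMap R (DR X) (X f k))
          (fun a b f => ?_) (fun f => ⟨Pi.single f 1, fun a => ?_⟩),
          Submodule.subset_span ⟨f, rfl⟩⟩
        · rw [h0]
          split_ifs
          exacts [Submodule.subset_span ⟨a, rfl⟩, zero_mem _]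
        · rw [h0, Pi.single_apply]
          split_ifs with h1
          · rw [h1, one_smul]
          · rw [zero_smul]
    exact hr
  have hfam : ∀ v : ι → DR X, (∀ a b f, E₀ a b (v f) = if a = f then -v b else 0) →
      ∀ f, v f ∈ finitary hmul := by
    intro v h0 f
    refine ⟨_, isFinitary_span_range v (fun a b f => ?_) (fun f => ⟨-Pi.single f 1, fun a => ?_⟩),
      Submodule.subset_span ⟨f, rfl⟩⟩
    · rw [h0]
      split_ifs
      exacts [neg_mem (Submodule.subset_span ⟨b, rfl⟩), zero_mem _]
    · rw [h0, Pi.neg_apply, Pi.single_apply]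
      split_ifs with h1
      · rw [h1, neg_smul, one_smul]
      · rw [neg_zero, zero_smul]
  have hfin : ∀ w : DR X, w ∈ finitary hmul := by
    intro w
    induction w using DR.induction with
    | hr r => exact hfinR r
    | hl j a => exact hfam (fun a => l X j a) (fun a b f => hEl a b j f) a
    | hθ j a => exact hfam (fun a => θ X j a) (fun a b f => hθ a b j f) a
    | hadd a b ha hb => exact add_mem ha hb
    | hmul a b ha hb => exact mul_mem ha hb
  obtain ⟨v', hvv', hv'⟩ := hGL.exists_invariant (W := (Bd X i).restrictScalars ℚ) (v := v)
    (fun w => by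
      obtain ⟨G, hG, hw⟩ := hfin w
      refine Submodule.span_mono ?_ (hG.2.2 hw)
      rintro u ⟨μ, hμ⟩
      refine ⟨μ + fun _ => (n : ℤ), fun a => ?_⟩
      rw [hE', if_pos rfl, ← hE₀, hμ a, Pi.add_apply, add_smul])
    (fun w => by
      obtain ⟨G, hG, hw⟩ := hfin w
      refine ⟨G, hG.1, hw, fun a b u hu => ?_⟩
      rw [hE']
      refine add_mem (hG.2.1 a b u hu) ?_
      split_ifs
      exacts [zsmul_mem hu _, zero_mem _])
    (fun a b u hu => by
      rw [hE']
      refine add_mem ((hE a b).mem_Bd hu) ?_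
      split_ifs
      exacts [zsmul_mem hu _, zero_mem _])
    (fun a b => by
      have h1 := coordinate_sub_gl_mem_Bd hE hEl hF hFl a b hv hdv
      have h2 : ∑ k, F b k (X a k • v) ∈ Bd X i := sum_mem fun k _ => (hF b k).mem_Bd (h a k)
      have h3 := sub_mem h2 h1
      simp only [(hF _ _).smul, hD, Finset.sum_add_distrib] at h3
      rw [hE']
      change _ ∈ Bd X i
      convert h3 using 1
      by_cases hab : a = b
      · simp [hab, hn, ← Nat.cast_smul_eq_nsmul R]
        abel
      · simp [hab, eq_comm (a := b)])
  have hv'i : v' ∈ Om X i := by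
    have h1 : v - v' ∈ Bd X i := hvv'
    have := sub_mem hv (Bd_le_Om i h1)
    rwa [sub_sub_cancel] at this
  have hEv' : ∀ a b, E a b v' = -(if a = b then (n : ℤ) • v' else 0) := fun a b =>
    eq_neg_of_add_eq_zero_left ((hE' a b v').symm.trans (hv' a b))
  have hT := sum_smul_gl_lift hD hE hEl hcl v'
  have htr : ∑ a, ∑ k, algebraMap R (DR X) (X a k) * l X k a = (n : DR X) := by
    have hlX : ∀ k, ∑ c, l X k c * algebraMap R (DR X) (X c k) = 1 := by
      intro k
      have : (l X * X.map (algebraMap R (DR X))) k k = 1 := by simp [(realizes X).l_X]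
      exact this
    rw [Finset.sum_comm]
    simp [Algebra.commutes, hlX, hn]
  have hv0 : ((i : ℤ) - (n * c : ℕ)) • v' = 0 := by
    have h1 : ∑ a : ι, ∑ b, ((if a = b then 1 else 0) -
        ∑ k, algebraMap R (DR X) (X b k) * l X k a) * E a b v' = -(((n : ℤ) * c) • v') := by
      simp only [hEv', mul_neg, mul_ite, mul_zero, Finset.sum_neg_distrib, Finset.sum_ite_eq,
        Finset.mem_univ, if_true]
      rw [← Finset.sum_mul, Finset.sum_sub_distrib, htr]
      simp only [Finset.sum_const, Finset.card_univ, hc, nsmul_eq_mul, mul_one]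
      rw [zsmul_eq_mul, zsmul_eq_mul]
      push_cast
      noncomm_ring
      rw [(Nat.cast_commute c (n : DR X)).left_comm]
    rw [h1, neg_inj, mem_Om.1 hv'i] at hT
    rw [sub_smul, sub_eq_zero, Nat.cast_mul, hT]
    simp
  have hv'0 : v' = 0 := by
    have := intCast_smul_cancel (⊥ : Submodule R (DR X)) _ (sub_ne_zero.2 (by exact_mod_cast hi)) v'
      ((Submodule.mem_bot R).2 hv0)
    exact (Submodule.mem_bot R).1 this
  rw [hv'0, sub_zero] at hvv'
  exact hvv'

/-- The augmented de Rham complex of a generic matrix is exact outside the degrees which are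
multiples of the difference of its sizes. -/
theorem exactAt_of_generic {c i : ℕ} (n : ℕ) : ∀ {R : Type} [CommRing R] [Algebra ℚ R]
    {ι κ : Type} [Fintype ι] [DecidableEq κ] [DecidableEq ι] [Fintype κ] {X : Matrix ι κ R},
    Generic X → Fintype.card κ = n → Fintype.card ι = n + c →
    (∀ s, 1 ≤ s → s ≤ n → i ≠ s * c) → ExactAt X i := by
  induction n with
  | zero =>
    intro R _ _ ι κ _ _ _ _ X _ hκ _ _
    have := Fintype.card_eq_zero_iff.1 hκ
    exact exactAt_of_isEmpty i
  | succ n ih =>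
    intro R _ _ ι κ _ _ _ _ X hX hκ hι hi w hw hdw
    let J : Ideal R := (Bd X i).comap (LinearMap.toSpanSingleton R (DR X) w)
    have hJ : ∀ r, r ∈ J ↔ r • w ∈ Bd X i := fun r => Iff.rfl
    let 𝔞 : Ideal R := Ideal.span (Set.range fun p : ι × κ => X p.1 p.2)
    have hrad : 𝔞 ≤ J.radical := by
      rw [Ideal.span_le]
      rintro _ ⟨⟨a, b⟩, rfl⟩
      let R' := Localization.Away (X a b)
      have hy : algebraMap R R' (X a b) * IsLocalization.Away.invSelf (X a b) = 1 :=
        IsLocalization.Away.mul_invSelf (X a b)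
      have hS := hX.schur a b R' hy
      have hex : ExactAt (X.map (algebraMap R R')) i := by
        refine ExactAt.of_schur (a₀ := a) (b₀ := b) hy (ih hS ?_ ?_ ?_)
        · simp [Fintype.card_subtype_compl, hκ]
        · simp [Fintype.card_subtype_compl, hι]
        · exact fun s h1 h2 => hi s h1 (by omega)
      have hdg := isDG_baseChange X R'
      obtain ⟨N, hN⟩ := exists_pow_smul_mem_Bd (X a b) (R' := R') (w := w) (i := i)
        (hex _ (hdg.mem_Om hw) (by rw [← hdg.d, hdw, map_zero]))
      exact ⟨N, (hJ _).2 hN⟩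
    obtain ⟨N, hN⟩ := Ideal.exists_pow_le_of_le_radical_of_fg hrad
      (Submodule.fg_span (Set.finite_range _))
    have h1 : ∀ N, 𝔞 ^ N ≤ J → (1 : R) ∈ J := by
      intro N
      induction N with
      | zero => intro h; exact h (by simp)
      | succ N ihN =>
        refine fun h => ihN fun r hr => ?_
        refine (hJ r).2 (mem_Bd_of_smul_mem_Bd hX (c := c) (by rw [hι, hκ])
          (by rw [hκ]; exact hi _ (by omega) le_rfl) (Submodule.smul_mem _ r hw)
          (by rw [d_smul, hdw, smul_zero]) fun a k => ?_)
        rw [smul_smul, ← hJ]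
        refine h ?_
        rw [pow_succ']
        exact Ideal.mul_mem_mul (Ideal.subset_span ⟨(a, k), rfl⟩) hr
    have := (hJ 1).1 (h1 N hN)
    rwa [one_smul] at this

end DR

end LeftInverse

namespace LeftInverse

open CategoryTheory Limits Opposite localCohomology

section Cochains

variable {R : Type} [CommRing R]

/-- A cochain on `P` with values in `M` is a cocycle. -/
def IsCocycle {P : ChainComplex (ModuleCat R) ℕ} {j : ℕ} {M : ModuleCat R} (φ : P.X j ⟶ M) : Prop :=
  ∀ l, P.d l j ≫ φ = 0

/-- A cochain on `P` with values in `M` is a coboundary. -/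
def IsCoboundary {P : ChainComplex (ModuleCat R) ℕ} {j : ℕ} {M : ModuleCat R} (φ : P.X j ⟶ M) :
    Prop :=
  ∃ (l : ℕ) (ψ : P.X l ⟶ M), P.d j l ≫ ψ = φ

variable {P Q : ChainComplex (ModuleCat R) ℕ} {j : ℕ} {M N : ModuleCat R}

lemma IsCocycle.comp {φ : P.X j ⟶ M} (h : IsCocycle φ) (f : M ⟶ N) : IsCocycle (φ ≫ f) :=
  fun l => by rw [← Category.assoc, h, zero_comp]

lemma IsCocycle.comap {φ : Q.X j ⟶ M} (h : IsCocycle φ) (G : P ⟶ Q) :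
    IsCocycle (G.f j ≫ φ) :=
  fun l => by rw [← G.comm_assoc, h, comp_zero]

lemma IsCoboundary.comp {φ : P.X j ⟶ M} (h : IsCoboundary φ) (f : M ⟶ N) :
    IsCoboundary (φ ≫ f) := by
  obtain ⟨l, ψ, rfl⟩ := h
  exact ⟨l, ψ ≫ f, by simp⟩

lemma IsCoboundary.comap {φ : Q.X j ⟶ M} (h : IsCoboundary φ) (G : P ⟶ Q) :
    IsCoboundary (G.f j ≫ φ) := by
  obtain ⟨l, ψ, rfl⟩ := h
  exact ⟨l, G.f l ≫ ψ, by simp⟩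

lemma isCoboundary_zero : IsCoboundary (0 : P.X j ⟶ M) := ⟨j, 0, by simp⟩

lemma isCoboundary_succ {φ : P.X (j + 1) ⟶ M} :
    IsCoboundary φ ↔ ∃ ψ : P.X j ⟶ M, P.d (j + 1) j ≫ ψ = φ := by
  refine ⟨?_, fun ⟨ψ, h⟩ => ⟨j, ψ, h⟩⟩
  rintro ⟨l, ψ, rfl⟩
  by_cases h : l = j
  · subst h
    exact ⟨ψ, rfl⟩
  · refine ⟨0, ?_⟩
    rw [P.shape (j + 1) l (by simpa using h), zero_comp, comp_zero]

lemma isCoboundary_zero_iff {φ : P.X 0 ⟶ M} : IsCoboundary φ ↔ φ = 0 := by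
  refine ⟨?_, fun h => h ▸ isCoboundary_zero⟩
  rintro ⟨l, ψ, rfl⟩
  rw [P.shape _ _ (by simp), zero_comp]

lemma IsCoboundary.add {φ ψ : P.X j ⟶ M} (hφ : IsCoboundary φ) (hψ : IsCoboundary ψ) :
    IsCoboundary (φ + ψ) := by
  cases j with
  | zero =>
    rw [isCoboundary_zero_iff] at *
    rw [hφ, hψ, add_zero]
  | succ j =>
    rw [isCoboundary_succ] at *
    obtain ⟨a, rfl⟩ := hφ
    obtain ⟨b, rfl⟩ := hψ
    exact ⟨a + b, by simp⟩

end Cochains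

variable {R : Type} [CommRing R] (I : Ideal R)

/-- A projective resolution of `R ⧸ I ^ t`. -/
noncomputable abbrev powRes (t : ℕ) :
    ProjectiveResolution ((ringModIdeals (idealPowersDiagram I)).obj (op t)) :=
  projectiveResolution _

/-- A chain map lifts the projection between the quotients by two powers of `I`. -/
def IsTransition {I : Ideal R} {t t' : ℕ} (h : t ≤ t')
    (G : (powRes I t').complex ⟶ (powRes I t).complex) : Prop :=
  G ≫ (powRes I t).π = (powRes I t').π ≫
    (ChainComplex.single₀ _).map ((ringModIdeals (idealPowersDiagram I)).map (homOfLE h).op)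

/-- Every cocycle of degree `j` with values in `M` on the resolution of a quotient `R ⧸ I ^ t`
becomes a coboundary on the resolution of some `R ⧸ I ^ t'`. -/
def VanishesAt (j : ℕ) (M : ModuleCat R) : Prop :=
  ∀ (t : ℕ) (φ : (powRes I t).complex.X j ⟶ M), IsCocycle φ →
    ∃ (t' : ℕ) (h : t ≤ t') (G : (powRes I t').complex ⟶ (powRes I t).complex),
      IsTransition h G ∧ IsCoboundary (G.f j ≫ φ)

variable {I}

lemma isTransition_id (t : ℕ) : IsTransition le_rfl (𝟙 (powRes I t).complex) := by
  simp [IsTransition]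

lemma IsTransition.comp {t t' t'' : ℕ} {h : t ≤ t'} {h' : t' ≤ t''}
    {G : (powRes I t').complex ⟶ (powRes I t).complex}
    {G' : (powRes I t'').complex ⟶ (powRes I t').complex} (hG : IsTransition h G)
    (hG' : IsTransition h' G') : IsTransition (h.trans h') (G' ≫ G) := by
  have : (homOfLE (h.trans h')).op = (homOfLE h').op ≫ (homOfLE h).op := rfl
  rw [IsTransition, Category.assoc, hG, ← Category.assoc, hG', Category.assoc, this,
    Functor.map_comp, Functor.map_comp]

lemma exists_isTransition {t t' : ℕ} (h : t ≤ t') :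
    ∃ G : (powRes I t').complex ⟶ (powRes I t).complex, IsTransition h G :=
  ⟨_, ProjectiveResolution.lift_commutes _ _ _⟩

lemma exists_cocycle {t j : ℕ} {M : ModuleCat R}
    (x : ((Ext R (ModuleCat R) j).obj (op ((ringModIdeals (idealPowersDiagram I)).obj (op t)))).obj
      M) :
    ∃ φ : (powRes I t).complex.X j ⟶ M, IsCocycle φ ∧ ∀ (t' : ℕ) (h : t ≤ t')
      (G : (powRes I t').complex ⟶ (powRes I t).complex), IsTransition h G →
      IsCoboundary (G.f j ≫ φ) → (((diagram (idealPowersDiagram I) j).map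
        (homOfLE h).op.op).app M).hom x = 0 := by
  let F := ((linearYoneda R (ModuleCat R)).obj M).rightOp
  let C := fun t => (F.mapHomologicalComplex (ComplexShape.down ℕ)).obj (powRes I t).complex
  let e := fun t => (powRes I t).isoLeftDerivedObj F j
  let x₁ : (unop ((C t).homology j) : ModuleCat R) := (e t).inv.unop.hom x
  have hx₁ : (e t).hom.unop.hom x₁ = x := by
    change ((e t).inv.unop ≫ (e t).hom.unop).hom x = x
    rw [← unop_comp, Iso.hom_inv_id]
    rfl
  have hsurj : Function.Surjective ((C t).homologyι j).unop.hom :=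
    (ModuleCat.epi_iff_surjective _).1 inferInstance
  obtain ⟨z, hz⟩ := hsurj x₁
  let φ : (powRes I t).complex.X j ⟶ M := ((C t).pOpcycles j).unop.hom z
  refine ⟨φ, fun l => ?_, fun t' h G hG hcob => ?_⟩
  · change (((C t).pOpcycles j).unop ≫ ((C t).d l j).unop).hom z = 0
    rw [← unop_comp, (C t).d_pOpcycles]
    rfl
  · obtain ⟨l, ψ, hψ⟩ := hcob
    let G' : C t' ⟶ C t := (F.mapHomologicalComplex _).map G
    have hinj : Function.Injective ((C t').pOpcycles j).unop.hom :=
      (ModuleCat.mono_iff_injective _).1 inferInstance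
    have h1 : (HomologicalComplex.opcyclesMap G' j).unop.hom z =
        ((C t').fromOpcycles j l).unop.hom ψ := by
      apply hinj
      change ((HomologicalComplex.opcyclesMap G' j).unop ≫ ((C t').pOpcycles j).unop).hom z =
        (((C t').fromOpcycles j l).unop ≫ ((C t').pOpcycles j).unop).hom ψ
      rw [← unop_comp, ← unop_comp, HomologicalComplex.p_opcyclesMap,
        HomologicalComplex.p_fromOpcycles]
      exact hψ.symm
    have h2 : (HomologicalComplex.homologyMap G' j).unop.hom x₁ = 0 := by
      rw [← hz]
      change (((C t).homologyι j).unop ≫ (HomologicalComplex.homologyMap G' j).unop).hom z = 0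
      rw [← unop_comp, HomologicalComplex.homologyι_naturality, unop_comp]
      change ((C t').homologyι j).unop.hom ((HomologicalComplex.opcyclesMap G' j).unop.hom z) = 0
      rw [h1]
      change (((C t').fromOpcycles j l).unop ≫ ((C t').homologyι j).unop).hom ψ = 0
      rw [← unop_comp, HomologicalComplex.homologyι_comp_fromOpcycles]
      rfl
    have h3 := Functor.leftDerived_map_eq F j _ G hG
    have h4 : ((diagram (idealPowersDiagram I) j).map (homOfLE h).op.op).app M =
        ((F.leftDerived j).map
          ((ringModIdeals (idealPowersDiagram I)).map (homOfLE h).op)).unop := rfl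
    rw [h4, h3]
    change (e t').hom.unop.hom ((HomologicalComplex.homologyMap G' j).unop.hom x₁) = 0
    exact (congrArg _ h2).trans (map_zero _)

theorem VanishesAt.subsingleton {j : ℕ} {M : ModuleCat R} (hM : VanishesAt I j M) :
    Subsingleton ((localCohomology I j).obj M) := by
  have hc := isColimitOfPreserves ((evaluation (ModuleCat R) (ModuleCat R)).obj M)
    (colimit.isColimit (diagram (idealPowersDiagram I) j))
  have h0 : 𝟙 ((localCohomology I j).obj M) = 0 := by
    refine hc.hom_ext fun t => ?_
    refine ModuleCat.hom_ext (LinearMap.ext fun x => ?_)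
    obtain ⟨φ, hφ, h⟩ := exists_cocycle (t := t.unop.unop) x
    obtain ⟨t', ht', G, hG, hcob⟩ := hM _ φ hφ
    have h1 := h t' ht' G hG hcob
    have h2 := (((evaluation (ModuleCat R) (ModuleCat R)).obj M).mapCocone
      (colimit.cocone (diagram (idealPowersDiagram I) j))).w (homOfLE ht').op.op
    have h3 := congrArg (fun f => f.hom x) h2
    refine h3.symm.trans ?_
    refine (congrArg _ h1).trans ?_
    exact LinearMap.map_zero _
  exact ModuleCat.subsingleton_of_isZero ((IsZero.iff_id_eq_zero _).2 h0)

end LeftInverse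

namespace LeftInverse

open CategoryTheory Limits Opposite localCohomology

section Cochains

variable {R : Type} [CommRing R]

lemma shortExact_of_exact {A B C : Type} [AddCommGroup A] [Module R A] [AddCommGroup B]
    [Module R B] [AddCommGroup C] [Module R C] {f : A →ₗ[R] B} {g : B →ₗ[R] C}
    (hf : Function.Injective f) (hfg : Function.Exact f g) (hg : Function.Surjective g) :
    ∃ S : ShortComplex (ModuleCat R), S.ShortExact ∧ S.X₁ = ModuleCat.of R A ∧
      S.X₂ = ModuleCat.of R B ∧ S.X₃ = ModuleCat.of R C := by
  refine ⟨ShortComplex.mk (ModuleCat.ofHom f) (ModuleCat.ofHom g) ?_, ?_, rfl, rfl, rfl⟩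
  · rw [← ModuleCat.ofHom_comp, hfg.linearMap_comp_eq_zero]
    rfl
  · refine ShortComplex.ShortExact.mk' ?_ ((ModuleCat.mono_iff_injective _).2 hf)
      ((ModuleCat.epi_iff_surjective _).2 hg)
    rw [ShortComplex.ShortExact.moduleCat_exact_iff_function_exact]
    exact hfg

lemma isCoboundary_of_shortExact {P : ChainComplex (ModuleCat R) ℕ} {j : ℕ}
    [Projective (P.X j)] {S : ShortComplex (ModuleCat R)} (hS : S.ShortExact)
    {φ : P.X (j + 1) ⟶ S.X₁} {ψ η : P.X j ⟶ S.X₂} (hφ : P.d (j + 1) j ≫ ψ = φ ≫ S.f)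
    (hη : IsCocycle η) (h : ψ ≫ S.g = η ≫ S.g) : IsCoboundary φ := by
  have := hS.mono_f
  refine isCoboundary_succ.2
    ⟨hS.exact.liftFromProjective (ψ - η) (by rw [Preadditive.sub_comp, h, sub_self]), ?_⟩
  rw [← cancel_mono S.f, Category.assoc, ShortComplex.Exact.liftFromProjective_comp,
    Preadditive.comp_sub, hφ, hη, sub_zero]

end Cochains

variable {R : Type} [CommRing R] {I : Ideal R}

theorem VanishesAt.of_shortExact {j : ℕ} {S : ShortComplex (ModuleCat R)} (hS : S.ShortExact)
    (h₂ : VanishesAt I (j + 1) S.X₂) (h₃ : VanishesAt I j S.X₃) :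
    VanishesAt I (j + 1) S.X₁ := by
  intro t φ hφ
  obtain ⟨t', h, G, hG, hcob⟩ := h₂ t (φ ≫ S.f) (hφ.comp _)
  obtain ⟨ψ, hψ⟩ := isCoboundary_succ.1 hcob
  have hcoc : IsCocycle (ψ ≫ S.g) := by
    intro l
    by_cases hl : l = j + 1
    · subst hl
      rw [reassoc_of% hψ, S.zero, comp_zero, comp_zero]
    · rw [HomologicalComplex.shape _ _ _ (by simpa using Ne.symm hl), zero_comp]
  obtain ⟨t'', h', G', hG', l, χ, hχ⟩ := h₃ t' _ hcoc
  have := hS.epi_g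
  have := (powRes I t'').projective
  refine ⟨t'', h.trans h', G' ≫ G, hG.comp hG', ?_⟩
  refine isCoboundary_of_shortExact hS (ψ := G'.f j ≫ ψ)
    (η := (powRes I t'').complex.d j l ≫ Projective.factorThru χ S.g) ?_ ?_ ?_
  · rw [← G'.comm_assoc, hψ]
    simp
  · intro l'
    simp
  · rw [Category.assoc, Category.assoc, Projective.factorThru_comp, hχ]

theorem VanishesAt.zero_of_mono {M N : ModuleCat R} (f : M ⟶ N) [Mono f]
    (h : VanishesAt I 0 N) : VanishesAt I 0 M := by
  intro t φ hφ
  obtain ⟨t', ht', G, hG, hcob⟩ := h t (φ ≫ f) (hφ.comp _)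
  refine ⟨t', ht', G, hG, ?_⟩
  rw [isCoboundary_zero_iff] at *
  rw [← cancel_mono f, Category.assoc, hcob, zero_comp]

theorem vanishesAt_succ_of_injective (j : ℕ) (E : ModuleCat R) [Injective E] :
    VanishesAt I (j + 1) E := fun t φ hφ =>
  ⟨t, le_rfl, 𝟙 _, isTransition_id t, isCoboundary_succ.2
    ⟨((powRes I t).exact_succ j).descToInjective φ (hφ _), by
      simpa using ((powRes I t).exact_succ j).comp_descToInjective φ (hφ _)⟩⟩

lemma isCoboundary_smul {t j : ℕ} {M : ModuleCat R} {φ : (powRes I t).complex.X j ⟶ M}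
    (hφ : IsCocycle φ) {a : R} (ha : a ∈ I ^ t) : IsCoboundary (a • φ) := by
  have h0 : a • 𝟙 ((ringModIdeals (idealPowersDiagram I)).obj (op t)) = 0 := by
    refine ModuleCat.hom_ext (LinearMap.ext fun x => ?_)
    obtain ⟨x, rfl⟩ := Ideal.Quotient.mk_surjective (I := I ^ t) x
    change a • Ideal.Quotient.mk (I ^ t) x = 0
    rw [Algebra.smul_def, Ideal.Quotient.algebraMap_eq, ← map_mul, Ideal.Quotient.eq_zero_iff_mem]
    exact Ideal.mul_mem_right _ _ ha
  have h1 : (a • 𝟙 (powRes I t).complex) ≫ (powRes I t).π = 0 := by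
    refine HomologicalComplex.to_single_hom_ext ?_
    let p : (powRes I t).complex.X 0 ⟶ (ringModIdeals (idealPowersDiagram I)).obj (op t) :=
      (powRes I t).π.f 0
    have h2 : a • p = 0 := by
      rw [← Category.comp_id p, ← Linear.comp_smul, h0, comp_zero]
    refine Eq.trans ?_ h2
    simp
    rfl
  let H := ProjectiveResolution.liftHomotopyZero _ h1
  refine ⟨_, H.hom ((ComplexShape.down ℕ).next j) j ≫ φ, ?_⟩
  have h2 : a • 𝟙 _ = (powRes I t).complex.d j _ ≫ H.hom ((ComplexShape.down ℕ).next j) j +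
      H.hom j _ ≫ (powRes I t).complex.d ((ComplexShape.down ℕ).prev j) j + 0 := H.comm j
  have h3 := congrArg (fun f => f ≫ φ) h2
  simpa [hφ _] using h3.symm

theorem vanishesAt_of_one_mem {j : ℕ} {M : ModuleCat R}
    (h : (1 : Module.End R M) ∈ I • (⊤ : Submodule R (Module.End R M))) : VanishesAt I j M := by
  have htop : I • (⊤ : Submodule R (Module.End R M)) = ⊤ := by
    refine eq_top_iff.2 fun f _ => ?_
    have : (I • (⊤ : Submodule R (Module.End R M))).map (LinearMap.mulLeft R f) ≤ I • ⊤ := by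
      rw [Submodule.map_smul'']
      exact Submodule.smul_mono le_rfl le_top
    simpa using this (Submodule.mem_map_of_mem h)
  have htop' : ∀ t : ℕ, I ^ t • (⊤ : Submodule R (Module.End R M)) = ⊤ := by
    intro t
    induction t with
    | zero => simp
    | succ t ih => rw [pow_succ, mul_smul, htop, ih]
  intro t φ hφ
  refine ⟨t, le_rfl, 𝟙 _, isTransition_id t, ?_⟩
  have hmem : ∀ f ∈ I ^ t • (⊤ : Submodule R (Module.End R M)),
      IsCoboundary (φ ≫ ModuleCat.ofHom f) := by
    intro f hf
    induction hf using Submodule.smul_induction_on' with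
    | smul a ha f _ =>
      convert (isCoboundary_smul hφ ha).comp (ModuleCat.ofHom f) using 1
      rw [Linear.smul_comp, ← Linear.comp_smul]
      rfl
    | add f _ g _ hf hg =>
      rw [ModuleCat.ofHom_add, Preadditive.comp_add]
      exact hf.add hg
  have := hmem 1 (by rw [htop']; trivial)
  have h1 : ModuleCat.ofHom (1 : Module.End R M) = 𝟙 M := rfl
  rw [h1, Category.comp_id] at this
  simpa using this

end LeftInverse

namespace LeftInverse

open CategoryTheory Limits Opposite localCohomology

variable {R : Type} [CommRing R] {I : Ideal R}

/-- Every element of `M` is killed by a power of `I`. -/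
def IsPowTorsion (I : Ideal R) (M : Type) [AddCommGroup M] [Module R M] : Prop :=
  ∀ x : M, ∃ k : ℕ, ∀ a ∈ I ^ k, a • x = 0

/-- The elements of `M` which are killed by a power of `I`. -/
def powTorsion (I : Ideal R) (M : Type) [AddCommGroup M] [Module R M] : Submodule R M where
  carrier := {x | ∃ k : ℕ, ∀ a ∈ I ^ k, a • x = 0}
  zero_mem' := ⟨0, fun a _ => smul_zero a⟩
  add_mem' := by
    rintro x y ⟨k, hk⟩ ⟨l, hl⟩
    refine ⟨max k l, fun a ha => ?_⟩
    rw [smul_add, hk a (Ideal.pow_le_pow_right (le_max_left _ _) ha),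
      hl a (Ideal.pow_le_pow_right (le_max_right _ _) ha), add_zero]
  smul_mem' := by
    rintro r x ⟨k, hk⟩
    exact ⟨k, fun a ha => by rw [smul_comm, hk a ha, smul_zero]⟩

variable {M N : Type} [AddCommGroup M] [Module R M] [AddCommGroup N] [Module R N]

lemma isPowTorsion_powTorsion : IsPowTorsion I (powTorsion I M) := by
  rintro ⟨x, k, hk⟩
  exact ⟨k, fun a ha => Subtype.ext (hk a ha)⟩

lemma IsPowTorsion.of_surjective (h : IsPowTorsion I M) {f : M →ₗ[R] N}
    (hf : Function.Surjective f) : IsPowTorsion I N := by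
  intro y
  obtain ⟨x, rfl⟩ := hf y
  obtain ⟨k, hk⟩ := h x
  exact ⟨k, fun a ha => by rw [← map_smul, hk a ha, map_zero]⟩

lemma IsPowTorsion.exists_pow_of_fg (h : IsPowTorsion I M) {p : Submodule R M} (hp : p.FG) :
    ∃ k : ℕ, ∀ a ∈ I ^ k, ∀ x ∈ p, a • x = 0 := by
  induction p, hp using Submodule.fg_induction with
  | singleton x =>
    obtain ⟨k, hk⟩ := h x
    refine ⟨k, fun a ha y hy => ?_⟩
    obtain ⟨r, rfl⟩ := Submodule.mem_span_singleton.1 hy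
    rw [smul_comm, hk a ha, smul_zero]
  | sup p q _ _ hp hq =>
    obtain ⟨k, hk⟩ := hp
    obtain ⟨l, hl⟩ := hq
    refine ⟨max k l, fun a ha x hx => ?_⟩
    obtain ⟨y, hy, z, hz, rfl⟩ := Submodule.mem_sup.1 hx
    rw [smul_add, hk a (Ideal.pow_le_pow_right (le_max_left _ _) ha) y hy,
      hl a (Ideal.pow_le_pow_right (le_max_right _ _) ha) z hz, add_zero]

theorem injective_powTorsion [IsNoetherianRing R] [Module.Injective R M] :
    Module.Injective R (powTorsion I M) := by
  refine Module.Baer.injective fun J g => ?_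
  have hfg : (LinearMap.range g).FG := by
    rw [LinearMap.range_eq_map]
    exact (IsNoetherian.noetherian ⊤).map g
  obtain ⟨k, hk⟩ := isPowTorsion_powTorsion.exists_pow_of_fg hfg
  obtain ⟨c, hc⟩ := I.exists_pow_inf_eq_pow_smul (M := R) J
  have hle : ∀ x : J, (x : R) ∈ I ^ (k + c) → g x = 0 := by
    intro x hxI
    have h1 : (x : R) ∈ I ^ k • J := by
      have h2 : (x : R) ∈ I ^ (k + c) • (⊤ : Submodule R R) ⊓ J := ⟨by simpa using hxI, x.2⟩
      rw [hc _ (Nat.le_add_left _ _), Nat.add_sub_cancel] at h2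
      exact Submodule.smul_mono le_rfl inf_le_right h2
    have h3 : I ^ k • J = (I ^ k • (⊤ : Submodule R J)).map J.subtype := by
      rw [Submodule.map_smul'', Submodule.map_top, Submodule.range_subtype]
    rw [h3] at h1
    obtain ⟨y, hy, hyx⟩ := h1
    obtain rfl : y = x := Subtype.ext hyx
    have h4 : I ^ k • (⊤ : Submodule R J) ≤ LinearMap.ker g :=
      Submodule.smul_le.2 fun a ha z _ => by
        rw [LinearMap.mem_ker, map_smul]
        exact hk a ha _ ⟨z, rfl⟩
    exact h4 hy
  let q : J →ₗ[R] R ⧸ I ^ (k + c) := (Submodule.mkQ (I ^ (k + c))).comp J.subtype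
  have hq : LinearMap.ker q ≤ LinearMap.ker ((powTorsion I M).subtype ∘ₗ g) := by
    intro x hx
    have hx' : (x : R) ∈ I ^ (k + c) := (Submodule.Quotient.mk_eq_zero _).1 hx
    rw [LinearMap.mem_ker, LinearMap.comp_apply, hle x hx', map_zero]
  obtain ⟨h, hh⟩ := Module.Injective.out ((LinearMap.ker q).liftQ q le_rfl)
    (LinearMap.ker_eq_bot.1 (Submodule.ker_liftQ_eq_bot' _ _ rfl))
    ((LinearMap.ker q).liftQ _ hq)
  refine ⟨(h ∘ₗ Submodule.mkQ (I ^ (k + c))).codRestrict (powTorsion I M) fun r =>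
    ⟨k + c, fun a ha => ?_⟩, fun x hx => Subtype.ext ?_⟩
  · rw [← map_smul, LinearMap.comp_apply, Submodule.mkQ_apply, smul_eq_mul,
      (Submodule.Quotient.mk_eq_zero _).2 (Ideal.mul_mem_right r _ ha), map_zero]
  · exact hh (Submodule.Quotient.mk ⟨x, hx⟩)

lemma exists_cocycle_lift {S : ShortComplex (ModuleCat R)} (hS : S.ShortExact)
    (hT : IsPowTorsion I S.X₂) {t : ℕ} {φ : (powRes I t).complex.X 0 ⟶ S.X₃} (hφ : IsCocycle φ) :
    ∃ (t' : ℕ) (h : t ≤ t') (G : (powRes I t').complex ⟶ (powRes I t).complex),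
      IsTransition h G ∧ ∃ η : (powRes I t').complex.X 0 ⟶ S.X₂, IsCocycle η ∧
        η ≫ S.g = G.f 0 ≫ φ := by
  let p : ∀ t, (powRes I t).complex.X 0 ⟶ (ringModIdeals (idealPowersDiagram I)).obj (op t) :=
    fun t => (powRes I t).π.f 0
  have hp : ∀ t l, (powRes I t).complex.d l 0 ≫ p t = 0 := by
    intro t l
    by_cases hl : l = 1
    · subst hl
      exact (powRes I t).complex_d_comp_π_f_zero
    · rw [HomologicalComplex.shape _ _ _ (by simpa using Ne.symm hl), zero_comp]
  obtain ⟨f, hf⟩ : ∃ f : (ringModIdeals (idealPowersDiagram I)).obj (op t) ⟶ S.X₃,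
      p t ≫ f = φ :=
    ⟨(powRes I t).isColimitCokernelCofork.desc (CokernelCofork.ofπ φ (hφ 1)),
      (powRes I t).isColimitCokernelCofork.fac (CokernelCofork.ofπ φ (hφ 1))
        WalkingParallelPair.one⟩
  obtain ⟨x, hx⟩ := (ModuleCat.epi_iff_surjective S.g).1 hS.epi_g
    (f.hom (Submodule.Quotient.mk (1 : R)))
  obtain ⟨k, hk⟩ := hT x
  obtain ⟨G, hG⟩ := exists_isTransition (I := I) (le_max_left t k)
  have hG0 : G.f 0 ≫ p t = p (max t k) ≫ (ringModIdeals (idealPowersDiagram I)).map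
      (homOfLE (le_max_left t k)).op := by
    have := HomologicalComplex.congr_hom hG 0
    refine this.trans ?_
    rw [HomologicalComplex.comp_f, ChainComplex.single₀_map_f_zero]
    rfl
  let f' : (ringModIdeals (idealPowersDiagram I)).obj (op (max t k)) ⟶ S.X₂ :=
    ModuleCat.ofHom ((I ^ (max t k)).liftQ (LinearMap.toSpanSingleton R S.X₂ x) fun a ha =>
      hk a (Ideal.pow_le_pow_right (le_max_right _ _) ha))
  have hf' : f' ≫ S.g = (ringModIdeals (idealPowersDiagram I)).map
      (homOfLE (le_max_left t k)).op ≫ f := by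
    refine ModuleCat.hom_ext (LinearMap.ext fun y => ?_)
    obtain ⟨r, rfl⟩ := Submodule.Quotient.mk_surjective (I ^ max t k) y
    change S.g.hom (r • x) = f.hom (Submodule.Quotient.mk r)
    rw [map_smul, hx]
    exact (LinearMap.map_smul f.hom r _).symm.trans
      (congrArg (fun s => f.hom (Submodule.Quotient.mk s)) (mul_one r))
  refine ⟨max t k, le_max_left _ _, G, hG, p _ ≫ f', fun l => ?_, ?_⟩
  · rw [← Category.assoc, hp, zero_comp]
  · rw [Category.assoc, hf', ← Category.assoc, ← hG0, Category.assoc, hf]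

lemma exists_shortExact_of_isPowTorsion [IsNoetherianRing R] (M : ModuleCat R)
    (hM : IsPowTorsion I M) : ∃ S : ShortComplex (ModuleCat R), S.ShortExact ∧ S.X₁ = M ∧
      Injective S.X₂ ∧ IsPowTorsion I S.X₂ ∧ IsPowTorsion I S.X₃ := by
  let E : ModuleCat R := Injective.under M
  let ι : M ⟶ E := Injective.ι M
  have hinj : Function.Injective ι.hom :=
    (ModuleCat.mono_iff_injective _).1 inferInstance
  let f : M →ₗ[R] powTorsion I E :=
    ι.hom.codRestrict (powTorsion I E) fun x => by
      obtain ⟨k, hk⟩ := hM x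
      exact ⟨k, fun a ha => by rw [← map_smul, hk a ha, map_zero]⟩
  have hf : Function.Injective f := fun x y h => hinj (congrArg Subtype.val h)
  obtain ⟨S, hS, h₁, h₂, h₃⟩ := shortExact_of_exact hf
    (LinearMap.exact_map_mkQ_range f) (Submodule.mkQ_surjective _)
  have hE : Injective (ModuleCat.of R E) := (inferInstance : Injective (Injective.under M))
  have : Module.Injective R E :=
    Module.injective_module_of_injective_object R _
  have := injective_powTorsion (I := I) (M := E)
  refine ⟨S, hS, h₁, ?_, ?_, ?_⟩
  · rw [h₂]
    exact Module.injective_object_of_injective_module R _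
  · rw [h₂]
    exact isPowTorsion_powTorsion
  · rw [h₃]
    exact isPowTorsion_powTorsion.of_surjective (Submodule.mkQ_surjective _)

/-- Local cohomology of torsion modules vanishes in positive degrees. -/
theorem vanishesAt_succ_of_isPowTorsion [IsNoetherianRing R] (j : ℕ) :
    ∀ M : ModuleCat R, IsPowTorsion I M → VanishesAt I (j + 1) M := by
  induction j with
  | zero =>
    intro M hM t φ hφ
    obtain ⟨S, hS, rfl, hinj, hT, -⟩ := exists_shortExact_of_isPowTorsion M hM
    obtain ⟨t', h, G, hG, hcob⟩ := vanishesAt_succ_of_injective (I := I) 0 S.X₂ t (φ ≫ S.f)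
      (hφ.comp _)
    obtain ⟨ψ, hψ⟩ := isCoboundary_succ.1 hcob
    have hcoc : IsCocycle (ψ ≫ S.g) := by
      intro l
      by_cases hl : l = 1
      · subst hl
        rw [reassoc_of% hψ, S.zero, comp_zero, comp_zero]
      · rw [HomologicalComplex.shape _ _ _ (by simpa using Ne.symm hl), zero_comp]
    obtain ⟨t'', h', G', hG', η, hη, hηg⟩ := exists_cocycle_lift hS hT hcoc
    have := (powRes I t'').projective
    refine ⟨t'', h.trans h', G' ≫ G, hG.comp hG', ?_⟩
    refine isCoboundary_of_shortExact hS (ψ := G'.f 0 ≫ ψ) (η := η) ?_ hη ?_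
    · rw [← G'.comm_assoc, hψ]
      simp
    · rw [hηg, Category.assoc]
  | succ j ih =>
    intro M hM
    obtain ⟨S, hS, rfl, hinj, -, hT⟩ := exists_shortExact_of_isPowTorsion M hM
    exact VanishesAt.of_shortExact hS (vanishesAt_succ_of_injective _ _) (ih _ hT)

end LeftInverse

namespace LeftInverse

open CategoryTheory localCohomology

section Exact

variable {R : Type} [CommRing R] {I : Ideal R} {A B C : Type} [AddCommGroup A] [Module R A]
  [AddCommGroup B] [Module R B] [AddCommGroup C] [Module R C]

lemma VanishesAt.of_exact {j : ℕ} {f : A →ₗ[R] B} {g : B →ₗ[R] C} (hf : Function.Injective f)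
    (hfg : Function.Exact f g) (hg : Function.Surjective g)
    (hB : VanishesAt I (j + 1) (ModuleCat.of R B)) (hC : VanishesAt I j (ModuleCat.of R C)) :
    VanishesAt I (j + 1) (ModuleCat.of R A) := by
  obtain ⟨S, hS, h₁, h₂, h₃⟩ := shortExact_of_exact hf hfg hg
  rw [← h₁]
  exact VanishesAt.of_shortExact hS (h₂ ▸ hB) (h₃ ▸ hC)

lemma VanishesAt.zero_of_injective {f : A →ₗ[R] B} (hf : Function.Injective f)
    (hB : VanishesAt I 0 (ModuleCat.of R B)) : VanishesAt I 0 (ModuleCat.of R A) := by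
  have : Mono (ModuleCat.ofHom f) := (ModuleCat.mono_iff_injective _).2 hf
  exact VanishesAt.zero_of_mono (ModuleCat.ofHom f) hB

lemma vanishesAt_of_subsingleton (j : ℕ) [Subsingleton A] : VanishesAt I j (ModuleCat.of R A) := by
  intro t φ _
  have : φ ≫ 𝟙 _ = 0 := by
    refine ModuleCat.hom_ext (LinearMap.ext fun x => ?_)
    exact Subsingleton.elim (α := A) _ _
  refine ⟨t, le_rfl, 𝟙 _, isTransition_id t, ?_⟩
  rw [Category.comp_id] at this
  rw [this, Limits.comp_zero]
  exact isCoboundary_zero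

lemma VanishesAt.of_equiv {j : ℕ} (e : A ≃ₗ[R] B) (hB : VanishesAt I j (ModuleCat.of R B)) :
    VanishesAt I j (ModuleCat.of R A) := by
  cases j with
  | zero => exact hB.zero_of_injective (f := e.toLinearMap) e.injective
  | succ j =>
    refine VanishesAt.of_exact (f := e.toLinearMap) (g := (0 : B →ₗ[R] PUnit)) e.injective
      (fun y => ⟨fun _ => e.surjective y, fun _ => rfl⟩) (fun y => ⟨0, rfl⟩) hB
      (vanishesAt_of_subsingleton j)

end Exact

namespace DR

variable {R : Type} [CommRing R] {ι κ : Type} [Fintype ι] [DecidableEq κ] {X : Matrix ι κ R}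

variable (X) in
/-- The differential as an `R`-linear map. -/
noncomputable def dLin : DR X →ₗ[R] DR X where
  toFun := d X
  map_add' := map_add _
  map_smul' := d_smul

variable (X) in
/-- The cycles of degree `k`. -/
noncomputable def Zc (k : ℕ) : Submodule R (DR X) := Om X k ⊓ LinearMap.ker (dLin X)

lemma Bd_le_Zc (k : ℕ) : Bd X k ≤ Zc X k := fun _ hw => ⟨Bd_le_Om k hw, d_of_mem_Bd hw⟩

/-- Local cohomology of the boundaries, by descending induction along the complex. -/
theorem vanishesAt_Bd [IsNoetherianRing R] {I : Ideal R} {i : ℕ}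
    (hOm : ∀ p k, VanishesAt I p (ModuleCat.of R (Om X k)))
    (hT : ∀ k, ∀ w ∈ Zc X k, ∃ N : ℕ, ∀ a ∈ I ^ N, a • w ∈ Bd X k)
    (hi : ExactAt X i) (p : ℕ) : ∀ k, p + k = i + 1 →
    VanishesAt I p (ModuleCat.of R (Bd X k)) := by
  induction p with
  | zero => exact fun k _ => (hOm 0 k).zero_of_injective (Submodule.inclusion_injective (Bd_le_Om k))
  | succ p ih =>
    intro k hk
    have hZ : VanishesAt I (p + 1) (ModuleCat.of R (Zc X k)) := by
      refine VanishesAt.of_exact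
        (f := Submodule.inclusion (inf_le_left : Zc X k ≤ Om X k))
        (g := ((dLin X).comp (Om X k).subtype).codRestrict (Bd X (k + 1))
          fun w => mem_Bd_succ.2 ⟨w, w.2, rfl⟩)
        (Submodule.inclusion_injective _) (fun w => ⟨fun h => ?_, ?_⟩) ?_
        (hOm _ _) (ih (k + 1) (by omega))
      · exact ⟨⟨w, w.2, congrArg Subtype.val h⟩, rfl⟩
      · rintro ⟨v, rfl⟩
        exact Subtype.ext v.2.2
      · rintro ⟨w, hw⟩
        obtain ⟨η, hη, rfl⟩ := mem_Bd_succ.1 hw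
        exact ⟨⟨η, hη⟩, rfl⟩
    let f := Submodule.inclusion (Bd_le_Zc (X := X) k)
    refine VanishesAt.of_exact (f := f) (Submodule.inclusion_injective _)
      (LinearMap.exact_map_mkQ_range f) (Submodule.mkQ_surjective _) hZ ?_
    cases p with
    | zero =>
      have hk : k = i := by omega
      subst hk
      have : Subsingleton (Zc X k ⧸ LinearMap.range f) := by
        rw [Submodule.Quotient.subsingleton_iff, eq_top_iff]
        rintro ⟨w, hw⟩ -
        exact ⟨⟨w, hi w hw.1 hw.2⟩, rfl⟩
      exact vanishesAt_of_subsingleton 0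
    | succ p =>
      refine vanishesAt_succ_of_isPowTorsion p _ fun x => ?_
      obtain ⟨⟨w, hw⟩, rfl⟩ := Submodule.mkQ_surjective (LinearMap.range f) x
      obtain ⟨N, hN⟩ := hT k w hw
      refine ⟨N, fun a ha => ?_⟩
      exact (Submodule.Quotient.mk_eq_zero _).2 ⟨⟨a • w, hN a ha⟩, rfl⟩

section Minors

variable [Fintype κ]

variable (X) in
/-- The ideal of maximal minors, allowing repeated rows. -/
def minors : Ideal R := Ideal.span (Set.range fun r : κ → ι => (X.submatrix r id).det)

lemma det_mul_eq_sum {Q : Type} [CommRing Q] (A : Matrix κ ι Q) (B : Matrix ι κ Q) :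
    (A * B).det = ∑ r : κ → ι, (∏ k, A k (r k)) * (B.submatrix r id).det := by
  have h : A * B = Matrix.of fun k => ∑ a, A k a • B a := by
    ext k j
    simp [Matrix.mul_apply]
  rw [h]
  refine ((Matrix.detRowAlternating (R := Q) (n := κ)).toMultilinearMap.map_sum
    (fun k a => A k a • B a)).trans (Finset.sum_congr rfl fun r _ => ?_)
  exact MultilinearMap.map_smul_univ _ (fun k => A k (r k)) (fun k => B (r k))

lemma one_mem_minors_smul : (1 : DR X) ∈ minors X • Om X 0 := by
  let C := Subring.center (DR X)
  let g : R →+* C := (algebraMap R (DR X)).codRestrict C algebraMap_mem_center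
  let L : Matrix κ ι C := Matrix.of fun j a => ⟨l X j a, l_mem_center j a⟩
  have hL : L * X.map g = 1 := by
    ext j k
    have h := congrFun (congrFun (realizes X).l_X j) k
    rw [Matrix.mul_apply] at h ⊢
    rw [AddSubmonoidClass.coe_finsetSum]
    refine h.trans ?_
    rw [Matrix.one_apply, Matrix.one_apply]
    split_ifs <;> rfl
  have h1 : ∑ r : κ → ι, (∏ k, L k (r k)) * g (X.submatrix r id).det = 1 := by
    rw [← Matrix.det_one (R := C) (n := κ), ← hL, det_mul_eq_sum]
    refine Finset.sum_congr rfl fun r _ => ?_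
    rw [RingHom.map_det]
    rfl
  have h2 := congrArg (Subtype.val) h1
  rw [AddSubmonoidClass.coe_finsetSum] at h2
  change _ = (1 : DR X) at h2
  rw [← h2]
  refine sum_mem fun r _ => ?_
  have h3 : (((∏ k, L k (r k)) * g (X.submatrix r id).det : C) : DR X) =
      (X.submatrix r id).det • ((∏ k, L k (r k) : C) : DR X) := by
    rw [mul_comm, Algebra.smul_def]
    rfl
  rw [h3]
  refine Submodule.smul_mem_smul (Ideal.subset_span ⟨r, rfl⟩) ?_
  refine Finset.prod_induction (fun k => L k (r k)) (fun c : C => (c : DR X) ∈ Om X 0)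
    (fun a b ha hb => ?_) one_mem_Om fun k _ => ?_
  · exact mul_mem_Om ha hb
  · rw [mem_Om, zero_smul]
    exact deg_l k (r k)

variable (X) in
/-- Left multiplication by forms of degree zero. -/
noncomputable def mulLin (k : ℕ) : Om X 0 →ₗ[R] Module.End R (Om X k) where
  toFun a := ((LinearMap.mulLeft R (a : DR X)).comp (Om X k).subtype).codRestrict (Om X k)
    fun w => by simpa using mul_mem_Om a.2 w.2
  map_add' a b := by ext w; exact add_mul _ _ _
  map_smul' r a := by ext w; exact smul_mul_assoc r (a : DR X) (w : DR X)

theorem vanishesAt_Om (p k : ℕ) : VanishesAt (minors X) p (ModuleCat.of R (Om X k)) := by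
  refine vanishesAt_of_one_mem ?_
  have h1 : (⟨1, one_mem_Om⟩ : Om X 0) ∈ minors X • (⊤ : Submodule R (Om X 0)) := by
    have h2 : minors X • Om X 0 = (minors X • (⊤ : Submodule R (Om X 0))).map (Om X 0).subtype := by
      rw [Submodule.map_smul'', Submodule.map_top, Submodule.range_subtype]
    have h3 := one_mem_minors_smul (X := X)
    rw [h2] at h3
    obtain ⟨y, hy, hyx⟩ := h3
    obtain rfl : y = ⟨1, one_mem_Om⟩ := Subtype.ext hyx
    exact hy
  have h2 := Submodule.mem_map_of_mem (f := mulLin X k) h1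
  rw [Submodule.map_smul''] at h2
  have h3 : mulLin X k ⟨1, one_mem_Om⟩ = 1 := by
    ext w
    exact one_mul _
  rw [h3] at h2
  exact Submodule.smul_mono le_rfl le_top h2

lemma exists_left_inverse [DecidableEq ι] {R' : Type} [CommRing R'] {Y : Matrix ι κ R'} {r : κ → ι}
    (h : IsUnit (Y.submatrix r id).det) : ∃ G : Matrix κ ι R', G * Y = 1 := by
  refine ⟨(Y.submatrix r id)⁻¹ * (1 : Matrix ι ι R').submatrix r id, ?_⟩
  have h1 : (1 : Matrix ι ι R').submatrix r id * Y = Y.submatrix r id := by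
    ext i j
    simp [Matrix.mul_apply, Matrix.one_apply]
  rw [Matrix.mul_assoc, h1, Matrix.nonsing_inv_mul _ h]

lemma exists_left_inverse_away [DecidableEq ι] (r : κ → ι) (R' : Type) [CommRing R'] [Algebra R R']
    [IsLocalization.Away (X.submatrix r id).det R'] :
    ∃ G : Matrix κ ι R', G * X.map (algebraMap R R') = 1 := by
  refine exists_left_inverse (r := r) ?_
  have h := IsLocalization.Away.algebraMap_isUnit (S := R') (X.submatrix r id).det
  rw [RingHom.map_det] at h
  exact h

theorem exists_pow_minors_smul_mem_Bd [Algebra ℚ R] [DecidableEq ι] {k : ℕ} {w : DR X}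
    (hw : w ∈ Zc X k) : ∃ N : ℕ, ∀ a ∈ minors X ^ N, a • w ∈ Bd X k := by
  let J : Ideal R := (Bd X k).comap (LinearMap.toSpanSingleton R (DR X) w)
  have hrad : minors X ≤ J.radical := by
    rw [minors, Ideal.span_le]
    rintro _ ⟨r, rfl⟩
    let R' := Localization.Away (X.submatrix r id).det
    obtain ⟨G, hG⟩ := exists_left_inverse_away (X := X) r R'
    have hdg := isDG_baseChange X R'
    obtain ⟨N, hN⟩ := exists_pow_smul_mem_Bd (X.submatrix r id).det (R' := R') (w := w) (i := k)
      (exactAt_of_left_inverse G hG k _ (hdg.mem_Om hw.1)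
        (by rw [← hdg.d, show d X w = 0 from hw.2, map_zero]))
    exact ⟨N, hN⟩
  obtain ⟨N, hN⟩ := Ideal.exists_pow_le_of_le_radical_of_fg hrad
    (Submodule.fg_span (Set.finite_range _))
  exact ⟨N, fun a ha => hN ha⟩

theorem algebraMap_injective_of_det_ne_zero [IsDomain R] [DecidableEq ι] {r : κ → ι}
    (hr : (X.submatrix r id).det ≠ 0) : Function.Injective (algebraMap R (DR X)) := by
  let R' := Localization.Away (X.submatrix r id).det
  obtain ⟨G, hG⟩ := exists_left_inverse_away (X := X) r R'
  have h1 := algebraMap_injective_of_left_inverse G hG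
  have h2 : Function.Injective (algebraMap R R') :=
    IsLocalization.injective R' (powers_le_nonZeroDivisors_of_noZeroDivisors hr)
  intro a b hab
  refine h2 (h1 ?_)
  rw [← (isDG_baseChange X R').algebraMap, ← (isDG_baseChange X R').algebraMap, hab]

/-- Local cohomology of a ring supported in the maximal minors of a matrix vanishes in degree zero
and one above each degree where the augmented de Rham complex is exact. -/
theorem vanishesAt_minors [Algebra ℚ R] [IsNoetherianRing R] [IsDomain R] [DecidableEq ι]
    {r : κ → ι} (hr : (X.submatrix r id).det ≠ 0) {j : ℕ} (hj : ∀ i, j = i + 1 → ExactAt X i) :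
    VanishesAt (minors X) j (ModuleCat.of R R) := by
  have hinj := algebraMap_injective_of_det_ne_zero hr
  let f : R →ₗ[R] Bd X 0 := (Algebra.linearMap R (DR X)).codRestrict (Bd X 0)
    fun s => mem_Bd_zero.2 ⟨s, rfl⟩
  have hf : Function.Bijective f := by
    refine ⟨fun a b h => hinj (congrArg Subtype.val h), fun ⟨w, hw⟩ => ?_⟩
    obtain ⟨s, rfl⟩ := mem_Bd_zero.1 hw
    exact ⟨s, rfl⟩
  refine VanishesAt.of_equiv (LinearEquiv.ofBijective f hf) ?_
  cases j with
  | zero => exact (vanishesAt_Om 0 0).zero_of_injective (Submodule.inclusion_injective (Bd_le_Om 0))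
  | succ i =>
    exact vanishesAt_Bd vanishesAt_Om (fun _ _ => exists_pow_minors_smul_mem_Bd) (hj i rfl) _ 0 rfl

end Minors

lemma minors_eq_span_strictMono {m n : ℕ} (Y : Matrix (Fin m) (Fin n) R) :
    minors Y = Ideal.span {p | ∃ g : Fin n → Fin m, StrictMono g ∧ p = (Y.submatrix g id).det} := by
  refine le_antisymm (Ideal.span_le.2 ?_) (Ideal.span_mono ?_)
  · rintro _ ⟨r, rfl⟩
    by_cases hr : Function.Injective r
    · let σ : Equiv.Perm (Fin n) := Tuple.sort r
      have hmono : StrictMono (r ∘ σ) :=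
        (Tuple.monotone_sort r).strictMono_of_injective (hr.comp σ.injective)
      have h1 : Y.submatrix r id = (Y.submatrix (r ∘ σ) id).submatrix (σ⁻¹ : Equiv.Perm (Fin n)) id := by
        ext i j
        simp
      change (Y.submatrix r id).det ∈ _
      rw [h1, Matrix.det_permute]
      exact Ideal.mul_mem_left _ _ (Ideal.subset_span ⟨_, hmono, rfl⟩)
    · rw [Function.Injective] at hr
      push Not at hr
      obtain ⟨a, b, hab, hne⟩ := hr
      have : (Y.submatrix r id).det = 0 :=
        Matrix.det_zero_of_row_eq hne (by ext k; simp [hab])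
      change (Y.submatrix r id).det ∈ _
      rw [this]
      exact zero_mem _
  · rintro _ ⟨g, -, rfl⟩
    exact ⟨g, rfl⟩

lemma det_generic_ne_zero {K : Type} [Field K] {m n : ℕ} (h : n ≤ m) :
    ((Matrix.of fun a j => (MvPolynomial.X (a, j) : MvPolynomial (Fin m × Fin n) K)).submatrix
      (Fin.castLE h) id).det ≠ 0 := by
  intro h0
  have h1 := congrArg (MvPolynomial.eval fun p : Fin m × Fin n =>
    if p.1 = Fin.castLE h p.2 then (1 : K) else 0) h0
  rw [RingHom.map_det, map_zero] at h1
  refine one_ne_zero ((Matrix.det_one (R := K) (n := Fin n)).symm.trans (Eq.trans ?_ h1))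
  congr 1
  ext i j
  simp [Matrix.one_apply]

end DR

end LeftInverse

open MvPolynomial

/-- The local cohomology modules of the polynomial ring `S` in the entries of the
generic `m × n` matrix, with support in the ideal of maximal minors, vanish in
cohomological degrees not of the form `s * (m - n) + 1` for `1 ≤ s ≤ n`. -/
theorem local_cohomology_maximal_minors_vanishing
    (K : Type) [Field K] [CharZero K] (m n : ℕ) (hn : 1 ≤ n) (hmn : n < m)
    (X : Matrix (Fin m) (Fin n) (MvPolynomial (Fin m × Fin n) K))
    (hX : ∀ i j, X i j = MvPolynomial.X (i, j))
    (I : Ideal (MvPolynomial (Fin m × Fin n) K))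
    (hI : I = Ideal.span {p | ∃ g : Fin n → Fin m, StrictMono g ∧
      p = (X.submatrix g id).det})
    (j : ℕ) (hj : ¬ ∃ s : ℕ, 1 ≤ s ∧ s ≤ n ∧ j = s * (m - n) + 1) :
    Subsingleton ((localCohomology I j).obj
      (ModuleCat.of (MvPolynomial (Fin m × Fin n) K) (MvPolynomial (Fin m × Fin n) K))) := by
  obtain rfl : X = Matrix.of fun i j => MvPolynomial.X (i, j) := Matrix.ext hX
  rw [← LeftInverse.DR.minors_eq_span_strictMono] at hI
  subst hI
  refine (LeftInverse.DR.vanishesAt_minors (LeftInverse.DR.det_generic_ne_zero hmn.le)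
    fun i hi => ?_).subsingleton
  refine LeftInverse.DR.exactAt_of_generic (c := m - n) n LeftInverse.generic_of_mvPolynomial
    (Fintype.card_fin n) (by rw [Fintype.card_fin]; omega) fun s h1 h2 h3 => hj ⟨s, h1, h2, ?_⟩
  rw [hi, h3]
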